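/- arXiv:1302.7040 — 4 statements merged into one kernel-verified Lean document; each statement's English description precedes it below -/
import Mathlib

section
/- Let p be a nonzero real number. The Jensen inequality Φ(A)^p ≤ Φ(A^p) holds for every unital completely positive linear map Φ : M₃ → M₂ and every 3×3 positive definite complex matrix A if and only if either 1 ≤ p ≤ 2 or −1 ≤ p < 0. -/
open scoped ComplexOrder

/-- Real functional calculus for Hermitian complex matrices, via the spectral theorem
(junk value `0` for non-Hermitian matrices). -/
noncomputable def Matrix.cfcReal {n : Type*} [Fintype n] [DecidableEq n]
    (f : ℝ → ℝ) (A : Matrix n n ℂ) : Matrix n n ℂ :=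
  if hA : A.IsHermitian then
    (hA.eigenvectorUnitary : Matrix n n ℂ) *
      Matrix.diagonal (fun i => (f (hA.eigenvalues i) : ℂ)) *
      star (hA.eigenvectorUnitary : Matrix n n ℂ)
  else 0

/-- The real power `A ^ r` of a Hermitian (in particular, positive definite) matrix,
defined by functional calculus, with the conventions `0 ^ r = 0` for `r ≠ 0` and `x ^ 0 = 1`. -/
noncomputable def Matrix.rpowH {n : Type*} [Fintype n] [DecidableEq n]
    (A : Matrix n n ℂ) (r : ℝ) : Matrix n n ℂ :=
  Matrix.cfcReal (fun t => t ^ r) A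

/-- The logarithm of a positive definite matrix, by functional calculus. -/
noncomputable def Matrix.logH {n : Type*} [Fintype n] [DecidableEq n]
    (A : Matrix n n ℂ) : Matrix n n ℂ :=
  Matrix.cfcReal Real.log A

/-- The exponential of a Hermitian matrix, by functional calculus. -/
noncomputable def Matrix.expH {n : Type*} [Fintype n] [DecidableEq n]
    (A : Matrix n n ℂ) : Matrix n n ℂ :=
  Matrix.cfcReal Real.exp A

/-- A linear map `Φ : Mₙ → Mₘ` (on complex matrices) is completely positive if for every
`k ∈ ℕ` the induced map `Φ ⊗ id : Mₙ ⊗ M_k → Mₘ ⊗ M_k` maps positive semidefinite matrices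
to positive semidefinite matrices. -/
def IsCompletelyPositive {n m : ℕ}
    (Φ : Matrix (Fin n) (Fin n) ℂ →ₗ[ℂ] Matrix (Fin m) (Fin m) ℂ) : Prop :=
  ∀ (k : ℕ) (M : Matrix (Fin n × Fin k) (Fin n × Fin k) ℂ), M.PosSemidef →
    (Matrix.of fun (i j : Fin m × Fin k) =>
      Φ (Matrix.of fun s t => M (s, i.2) (t, j.2)) i.1 j.1).PosSemidef



open Matrix in
lemma aux_cfc_eq {n : Type*} [Fintype n] [DecidableEq n] {A : Matrix n n ℂ}
    (hA : A.IsHermitian) (f : ℝ → ℝ) : Matrix.cfcReal f A =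
    (hA.eigenvectorUnitary : Matrix n n ℂ) *
      Matrix.diagonal (fun i => (f (hA.eigenvalues i) : ℂ)) *
      star (hA.eigenvectorUnitary : Matrix n n ℂ) := by
  unfold Matrix.cfcReal
  rw [dif_pos hA]

lemma aux_cfc_mul {n : Type*} [Fintype n] [DecidableEq n] {A : Matrix n n ℂ}
    (hA : A.IsHermitian) (f g : ℝ → ℝ) :
    Matrix.cfcReal f A * Matrix.cfcReal g A = Matrix.cfcReal (fun t => f t * g t) A := by
  simp only [aux_cfc_eq hA]
  have h := Unitary.coe_star_mul_self hA.eigenvectorUnitary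
  set U := (hA.eigenvectorUnitary : Matrix n n ℂ)
  calc _ = U * Matrix.diagonal (fun i => (f (hA.eigenvalues i) : ℂ)) * (star U * U) *
        Matrix.diagonal (fun i => (g (hA.eigenvalues i) : ℂ)) * star U := by
          simp only [Matrix.mul_assoc]
    _ = _ := by
      rw [h, Matrix.mul_one, Matrix.mul_assoc U, Matrix.diagonal_mul_diagonal]
      simp

lemma aux_cfc_id {n : Type*} [Fintype n] [DecidableEq n] {A : Matrix n n ℂ}
    (hA : A.IsHermitian) : Matrix.cfcReal (fun t => t) A = A := by
  rw [aux_cfc_eq hA]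
  conv_rhs => rw [hA.spectral_theorem, Unitary.conjStarAlgAut_apply]
  rfl

lemma aux_cfc_one {n : Type*} [Fintype n] [DecidableEq n] {A : Matrix n n ℂ}
    (hA : A.IsHermitian) : Matrix.cfcReal (fun _ => 1) A = 1 := by
  rw [aux_cfc_eq hA]
  simp

lemma aux_cfc_herm {n : Type*} [Fintype n] [DecidableEq n] {A : Matrix n n ℂ}
    (hA : A.IsHermitian) (f : ℝ → ℝ) : (Matrix.cfcReal f A).IsHermitian := by
  rw [aux_cfc_eq hA, Matrix.IsHermitian, Matrix.star_eq_conjTranspose]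
  simp only [Matrix.conjTranspose_mul, Matrix.conjTranspose_conjTranspose,
    Matrix.diagonal_conjTranspose, Matrix.mul_assoc]
  congr 3
  ext i
  simp

lemma aux_cfc_add {n : Type*} [Fintype n] [DecidableEq n] {A : Matrix n n ℂ}
    (hA : A.IsHermitian) (f g : ℝ → ℝ) :
    Matrix.cfcReal f A + Matrix.cfcReal g A = Matrix.cfcReal (fun t => f t + g t) A := by
  simp only [aux_cfc_eq hA, ← Matrix.add_mul, ← Matrix.mul_add, Matrix.diagonal_add]
  simp

/-- only values at the eigenvalues matter -/
lemma aux_cfc_congr {n : Type*} [Fintype n] [DecidableEq n] {A : Matrix n n ℂ}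
    (hA : A.IsHermitian) (f g : ℝ → ℝ) (h : ∀ i, f (hA.eigenvalues i) = g (hA.eigenvalues i)) :
    Matrix.cfcReal f A = Matrix.cfcReal g A := by
  simp only [aux_cfc_eq hA, h]

/-- spectral resolution -/
lemma aux_spec {n : Type*} [Fintype n] [DecidableEq n] {A : Matrix n n ℂ}
    (hA : A.IsHermitian) : ∃ P : n → Matrix n n ℂ, (∀ i, (P i).PosSemidef) ∧
      ∀ f : ℝ → ℝ, Matrix.cfcReal f A = ∑ i, (f (hA.eigenvalues i) : ℂ) • P i := by
  refine ⟨fun i => (hA.eigenvectorUnitary : Matrix n n ℂ) * Matrix.diagonal (Pi.single i 1) *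
    (hA.eigenvectorUnitary : Matrix n n ℂ).conjTranspose, fun i => ?_, fun f => ?_⟩
  · apply Matrix.PosSemidef.mul_mul_conjTranspose_same
    apply Matrix.PosSemidef.diagonal
    intro j
    by_cases h : j = i
    · subst h; simp
    · simp [Pi.single_eq_of_ne h]
  · have hd : Matrix.diagonal (fun i => (f (hA.eigenvalues i) : ℂ)) =
        ∑ i, (f (hA.eigenvalues i) : ℂ) • Matrix.diagonal (Pi.single i (1 : ℂ)) := by
      ext i j
      rw [Matrix.sum_apply]
      by_cases h : i = j
      · subst h
        simp [Pi.single_apply]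
      · simp [Matrix.diagonal_apply_ne _ h]
    rw [aux_cfc_eq hA, hd]
    simp only [Finset.sum_mul, Finset.mul_sum, Matrix.smul_mul, Matrix.mul_smul,
      Matrix.star_eq_conjTranspose]

/-- the spectral weights of a vector -/
lemma aux_weights {n : Type*} [Fintype n] [DecidableEq n] {A : Matrix n n ℂ}
    (hA : A.IsHermitian) (v : n → ℂ) : ∃ b : n → ℝ, (∀ i, 0 ≤ b i) ∧
      ∀ f : ℝ → ℝ, star v ⬝ᵥ (Matrix.cfcReal f A).mulVec v =
        ((∑ i, b i * f (hA.eigenvalues i) : ℝ) : ℂ) := by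
  obtain ⟨P, hP, h⟩ := aux_spec hA
  have hr : ∀ i, star v ⬝ᵥ (P i).mulVec v = (((star v ⬝ᵥ (P i).mulVec v).re : ℝ) : ℂ) := by
    intro i
    have := (hP i).dotProduct_mulVec_nonneg v
    exact Complex.eq_re_of_ofReal_le (r := 0) (by rwa [Complex.ofReal_zero])
  refine ⟨fun i => (star v ⬝ᵥ (P i).mulVec v).re, fun i => ?_, fun f => ?_⟩
  · exact (Complex.le_def.1 ((hP i).dotProduct_mulVec_nonneg v)).1
  · rw [h]
    simp only [Matrix.sum_mulVec, dotProduct_sum, Matrix.smul_mulVec, dotProduct_smul, smul_eq_mul]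
    push_cast
    refine Finset.sum_congr rfl fun i _ => ?_
    conv_lhs => rw [hr i]
    ring

/-- Choi's inequality for the inverse of a finite positive combination. -/
lemma aux_choi {ι n : Type*} [Fintype ι] [Fintype n] [DecidableEq n]
    (E : ι → Matrix n n ℂ) (hE : ∀ i, (E i).PosSemidef) (m : ι → ℝ)
    (hm : ∀ i, 0 < m i) (hs : ∑ i, E i = 1) (G : Matrix n n ℂ) (hG : G.IsHermitian)
    (hGB : G * (∑ i, (m i : ℂ) • E i) = 1) :
    ((∑ i, ((m i)⁻¹ : ℂ) • E i) - G).PosSemidef := by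
  have key : (∑ i, ((m i)⁻¹ : ℂ) • E i) - G =
      ∑ i, ((m i)⁻¹ : ℂ) • ((1 - (m i : ℂ) • G).conjTranspose * E i * (1 - (m i : ℂ) • G)) := by
    have e : ∀ i, ((m i)⁻¹ : ℂ) • ((1 - (m i : ℂ) • G).conjTranspose * E i * (1 - (m i : ℂ) • G))
        = ((m i)⁻¹ : ℂ) • E i - G * E i - E i * G + G * ((m i : ℂ) • E i) * G := by
      intro i
      have h0 : (m i : ℂ) ≠ 0 := by exact_mod_cast (hm i).ne'
      have : (1 - (m i : ℂ) • G).conjTranspose = 1 - (m i : ℂ) • G := by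
        rw [Matrix.conjTranspose_sub, Matrix.conjTranspose_smul, hG.eq]
        simp
      rw [this]
      simp only [Matrix.sub_mul, Matrix.mul_sub, Matrix.one_mul, Matrix.mul_one, Matrix.smul_mul,
        Matrix.mul_smul, smul_sub, smul_smul, inv_mul_cancel₀ h0, one_smul, ← mul_assoc, one_mul]
      abel
    simp only [e, Finset.sum_add_distrib, Finset.sum_sub_distrib, ← Finset.sum_mul,
      ← Finset.mul_sum, hs, hGB, Matrix.mul_one, Matrix.one_mul]
    abel
  rw [key]
  refine Matrix.posSemidef_sum _ fun i _ => ?_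
  refine Matrix.PosSemidef.smul ((hE i).conjTranspose_mul_mul_same _) ?_
  have : (0:ℝ) ≤ (m i)⁻¹ := (inv_pos.2 (hm i)).le
  exact_mod_cast this

open MeasureTheory Set in
/-- Scalar integration step. -/
lemma aux_scalar {ι κ : Type*} [Fintype ι] [Fintype κ] (a l : ι → ℝ) (b r : κ → ℝ)
    (hl : ∀ i, 0 < l i) (hr : ∀ j, 0 < r j) (h0 : ∑ j, b j = ∑ i, a i)
    (h1 : ∑ j, b j * r j = ∑ i, a i * l i)
    (hinv : ∀ x : ℝ, 0 ≤ x → ∑ j, b j * (x + r j)⁻¹ ≤ ∑ i, a i * (x + l i)⁻¹)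
    (p : ℝ) (hp : (1 < p ∧ p < 2) ∨ (-1 < p ∧ p < 0)) :
    ∑ j, b j * r j ^ p ≤ ∑ i, a i * l i ^ p := by
  rcases hp with hp | hp
  · obtain ⟨μ, hμ⟩ := Real.exists_measure_rpow_eq_integral_rpowIntegrand₀₁
      (p := p - 1) ⟨by linarith, by linarith⟩
    have e : ∀ x : ℝ, 0 < x → ∀ c : ℝ, c * x ^ p =
        ∫ t in Ioi 0, c * (x * Real.rpowIntegrand₀₁ (p - 1) t x) ∂μ := by
      intro x hx c
      rw [integral_const_mul, integral_const_mul, ← (hμ x hx.le).2]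
      congr 1
      rw [Real.rpow_sub_one hx.ne']; field_simp
    have i : ∀ x : ℝ, 0 < x → ∀ c : ℝ,
        Integrable (fun t => c * (x * Real.rpowIntegrand₀₁ (p - 1) t x)) (μ.restrict (Ioi 0)) :=
      fun x hx c => ((hμ x hx.le).1.const_mul x).const_mul c
    simp only [e _ (hl _), e _ (hr _)]
    rw [← integral_finsetSum _ (fun j _ => i _ (hr j) _),
      ← integral_finsetSum _ (fun j _ => i _ (hl j) _)]
    refine setIntegral_mono_on (integrable_finsetSum _ (fun j _ => i _ (hr j) _))
      (integrable_finsetSum _ (fun j _ => i _ (hl j) _)) measurableSet_Ioi fun t ht => ?_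
    have ht : 0 < t := ht
    have f : ∀ x : ℝ, 0 < x → ∀ c : ℝ, c * (x * Real.rpowIntegrand₀₁ (p - 1) t x) =
        t ^ (p - 1) * (t⁻¹ * (c * x) - c + t * (c * (t + x)⁻¹)) := by
      intro x hx c
      unfold Real.rpowIntegrand₀₁
      field_simp
      ring
    simp only [f _ (hl _), f _ (hr _), ← Finset.mul_sum, Finset.sum_add_distrib,
      Finset.sum_sub_distrib, h0, h1]
    have := hinv t ht.le
    gcongr
  · obtain ⟨μ, hμ⟩ := Real.exists_measure_rpow_eq_integral_rpowIntegrand₀₁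
      (p := p + 1) ⟨by linarith, by linarith⟩
    have e : ∀ x : ℝ, 0 < x → ∀ c : ℝ, c * x ^ p =
        ∫ t in Ioi 0, c * (x⁻¹ * Real.rpowIntegrand₀₁ (p + 1) t x) ∂μ := by
      intro x hx c
      rw [integral_const_mul, integral_const_mul, ← (hμ x hx.le).2]
      congr 1
      rw [Real.rpow_add_one hx.ne']; field_simp
    have i : ∀ x : ℝ, 0 < x → ∀ c : ℝ,
        Integrable (fun t => c * (x⁻¹ * Real.rpowIntegrand₀₁ (p + 1) t x)) (μ.restrict (Ioi 0)) :=
      fun x hx c => ((hμ x hx.le).1.const_mul x⁻¹).const_mul c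
    simp only [e _ (hl _), e _ (hr _)]
    rw [← integral_finsetSum _ (fun j _ => i _ (hr j) _),
      ← integral_finsetSum _ (fun j _ => i _ (hl j) _)]
    refine setIntegral_mono_on (integrable_finsetSum _ (fun j _ => i _ (hr j) _))
      (integrable_finsetSum _ (fun j _ => i _ (hl j) _)) measurableSet_Ioi fun t ht => ?_
    have ht : 0 < t := ht
    have f : ∀ x : ℝ, 0 < x → ∀ c : ℝ, c * (x⁻¹ * Real.rpowIntegrand₀₁ (p + 1) t x) =
        t ^ (p + 1) * (t⁻¹ * (c * (t + x)⁻¹)) := by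
      intro x hx c
      unfold Real.rpowIntegrand₀₁
      field_simp
      ring
    simp only [f _ (hl _), f _ (hr _), ← Finset.mul_sum]
    have := hinv t ht.le
    gcongr

open Filter Topology in
lemma aux_scalar' {ι κ : Type*} [Fintype ι] [Fintype κ] (a l : ι → ℝ) (b r : κ → ℝ)
    (hl : ∀ i, 0 < l i) (hr : ∀ j, 0 < r j) (h0 : ∑ j, b j = ∑ i, a i)
    (h1 : ∑ j, b j * r j = ∑ i, a i * l i)
    (hinv : ∀ x : ℝ, 0 ≤ x → ∑ j, b j * (x + r j)⁻¹ ≤ ∑ i, a i * (x + l i)⁻¹)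
    (p : ℝ) (hp : (1 ≤ p ∧ p ≤ 2) ∨ (-1 ≤ p ∧ p < 0)) :
    ∑ j, b j * r j ^ p ≤ ∑ i, a i * l i ^ p := by
  have main := aux_scalar a l b r hl hr h0 h1 hinv
  by_cases h2 : p = 2
  · subst h2
    have c : Continuous fun q : ℝ => ∑ i, a i * l i ^ q :=
      continuous_finsetSum _ fun i _ => continuous_const.mul
        (Real.continuous_const_rpow (hl i).ne')
    have d : Continuous fun q : ℝ => ∑ i, b i * r i ^ q :=
      continuous_finsetSum _ fun i _ => continuous_const.mul
        (Real.continuous_const_rpow (hr i).ne')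
    refine le_of_tendsto_of_tendsto (b := 𝓝[<] (2:ℝ)) (d.continuousAt.tendsto.mono_left
      nhdsWithin_le_nhds) (c.continuousAt.tendsto.mono_left nhdsWithin_le_nhds) ?_
    have : Set.Ioo (1:ℝ) 2 ∈ 𝓝[<] (2:ℝ) := Ioo_mem_nhdsLT (by norm_num)
    filter_upwards [this] with q hq
    exact main q (Or.inl ⟨hq.1, hq.2⟩)
  · by_cases h3 : p = 1
    · subst h3; simpa using h1.le
    · by_cases h4 : p = -1
      · subst h4
        simpa [Real.rpow_neg_one] using hinv 0 le_rfl
      · apply main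
        rcases hp with hp | hp
        · exact Or.inl ⟨lt_of_le_of_ne hp.1 (Ne.symm h3), lt_of_le_of_ne hp.2 h2⟩
        · exact Or.inr ⟨lt_of_le_of_ne hp.1 (Ne.symm h4), hp.2⟩


lemma aux_cfc_const {n : Type*} [Fintype n] [DecidableEq n] {A : Matrix n n ℂ}
    (hA : A.IsHermitian) (x : ℝ) : Matrix.cfcReal (fun _ => x) A = (x : ℂ) • 1 := by
  rw [aux_cfc_eq hA]
  have h := Unitary.coe_mul_star_self hA.eigenvectorUnitary
  have : (Matrix.diagonal fun _ : n => (x : ℂ)) = (x : ℂ) • 1 := by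
    rw [Matrix.smul_one_eq_diagonal]
  rw [this, Matrix.mul_smul, Matrix.smul_mul, Matrix.mul_one]
  congr 1

lemma aux_pos {n m : ℕ} (Φ : Matrix (Fin n) (Fin n) ℂ →ₗ[ℂ] Matrix (Fin m) (Fin m) ℂ)
    (h : IsCompletelyPositive Φ) (M : Matrix (Fin n) (Fin n) ℂ) (hM : M.PosSemidef) :
    (Φ M).PosSemidef := by
  have h1 := h 1 (M.submatrix Prod.fst Prod.fst) (hM.submatrix _)
  have h2 := h1.submatrix (fun i : Fin m => (i, (0 : Fin 1)))
  exact h2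

lemma aux_forward (p : ℝ) (hp : (1 ≤ p ∧ p ≤ 2) ∨ (-1 ≤ p ∧ p < 0))
    {n m : ℕ} (Φ : Matrix (Fin n) (Fin n) ℂ →ₗ[ℂ] Matrix (Fin m) (Fin m) ℂ)
    (h1 : Φ 1 = 1) (hΦ : ∀ M : Matrix (Fin n) (Fin n) ℂ, M.PosSemidef → (Φ M).PosSemidef)
    (A : Matrix (Fin n) (Fin n) ℂ) (hA : A.PosDef) :
    (Φ (Matrix.rpowH A p) - Matrix.rpowH (Φ A) p).PosSemidef := by
  obtain ⟨P, hP, hf⟩ := aux_spec hA.1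
  have hl := hA.eigenvalues_pos
  set l := hA.1.eigenvalues with hldef
  have hE : ∀ i, (Φ (P i)).PosSemidef := fun i => hΦ _ (hP i)
  have hΦf : ∀ f : ℝ → ℝ, Φ (Matrix.cfcReal f A) = ∑ i, (f (l i) : ℂ) • Φ (P i) := by
    intro f
    rw [hf, map_sum]
    simp only [map_smul]
  have hsum : ∑ i, Φ (P i) = 1 := by
    have := hΦf (fun _ => 1)
    rw [aux_cfc_one hA.1, h1] at this
    simpa using this.symm
  have hB : Φ A = ∑ i, (l i : ℂ) • Φ (P i) := by
    have := hΦf (fun t => t)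
    rwa [aux_cfc_id hA.1] at this
  have hBpd : (Φ A).PosDef := by
    obtain ⟨c, hc, hcl⟩ : ∃ c : ℝ, 0 < c ∧ ∀ i, c ≤ l i := by
      rcases isEmpty_or_nonempty (Fin n) with he | he
      · exact ⟨1, one_pos, fun i => he.elim i⟩
      · obtain ⟨i, hi⟩ := Finite.exists_min l
        exact ⟨l i, hl i, hi⟩
    have e : Φ A = ∑ i, ((l i - c : ℝ) : ℂ) • Φ (P i) + (c : ℂ) • 1 := by
      rw [hB, ← hsum, Finset.smul_sum, ← Finset.sum_add_distrib]
      refine Finset.sum_congr rfl fun i _ => ?_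
      rw [← add_smul]
      simp
    rw [e]
    refine Matrix.PosDef.posSemidef_add (Matrix.posSemidef_sum _ fun i _ => (hE i).smul ?_)
      (Matrix.PosDef.smul Matrix.PosDef.one ?_)
    · have : 0 ≤ l i - c := sub_nonneg.2 (hcl i)
      exact_mod_cast this
    · exact_mod_cast hc
  have hr := hBpd.eigenvalues_pos
  refine Matrix.PosSemidef.of_dotProduct_mulVec_nonneg ?_ ?_
  · refine Matrix.IsHermitian.sub ?_ (aux_cfc_herm hBpd.1 _)
    have : (Matrix.rpowH A p).PosSemidef := by
      unfold Matrix.rpowH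
      rw [hf]
      refine Matrix.posSemidef_sum _ fun i _ => (hP i).smul ?_
      have : 0 ≤ l i ^ p := Real.rpow_nonneg (hl i).le _
      exact_mod_cast this
    exact (hΦ _ this).1
  intro v
  obtain ⟨b, hb, hbf⟩ := aux_weights hBpd.1 v
  set r := hBpd.1.eigenvalues with hrdef
  have hre : ∀ i, star v ⬝ᵥ (Φ (P i)).mulVec v =
      (((star v ⬝ᵥ (Φ (P i)).mulVec v).re : ℝ) : ℂ) := by
    intro i
    have := (hE i).dotProduct_mulVec_nonneg v
    exact Complex.eq_re_of_ofReal_le (r := 0) (by rwa [Complex.ofReal_zero])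
  set a : Fin n → ℝ := fun i => (star v ⬝ᵥ (Φ (P i)).mulVec v).re with ha
  have haf : ∀ f : ℝ → ℝ, star v ⬝ᵥ (∑ i, (f (l i) : ℂ) • Φ (P i)).mulVec v =
      ((∑ i, a i * f (l i) : ℝ) : ℂ) := by
    intro f
    simp only [Matrix.sum_mulVec, dotProduct_sum, Matrix.smul_mulVec, dotProduct_smul, smul_eq_mul]
    push_cast
    refine Finset.sum_congr rfl fun i _ => ?_
    conv_lhs => rw [hre i]
    rw [mul_comm]
  have H := aux_scalar' a l b r hl hr ?_ ?_ ?_ p hp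
  · unfold Matrix.rpowH
    rw [Matrix.sub_mulVec, dotProduct_sub, hbf, hΦf, haf (fun t => t ^ p), ← Complex.ofReal_sub]
    have := sub_nonneg.2 H
    exact_mod_cast this
  · have e1 := hbf (fun _ => 1)
    have e2 := haf (fun _ => 1)
    rw [aux_cfc_one hBpd.1] at e1
    simp only [Complex.ofReal_one, one_smul, hsum] at e2
    have := e1.symm.trans e2
    have := Complex.ofReal_injective this
    simpa using this
  · have e1 := hbf (fun t => t)
    have e2 := haf (fun t => t)
    rw [aux_cfc_id hBpd.1] at e1
    rw [← hB] at e2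
    exact Complex.ofReal_injective (e1.symm.trans e2)
  · intro x hx
    have hG : Matrix.cfcReal (fun t => (x + t)⁻¹) (Φ A) *
        ∑ i, ((x + l i : ℝ) : ℂ) • Φ (P i) = 1 := by
      rw [← hΦf (fun t => x + t)]
      have : Φ (Matrix.cfcReal (fun t => x + t) A) = Matrix.cfcReal (fun t => x + t) (Φ A) := by
        rw [hΦf, ← aux_cfc_add hBpd.1 (fun _ => x) (fun t => t), aux_cfc_id hBpd.1, aux_cfc_const hBpd.1, hB,
          ← hsum, Finset.smul_sum, ← Finset.sum_add_distrib]
        refine Finset.sum_congr rfl fun i _ => ?_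
        rw [← add_smul]
        simp
      rw [this, aux_cfc_mul hBpd.1, ← aux_cfc_one hBpd.1]
      refine aux_cfc_congr hBpd.1 _ _ fun i => ?_
      have := hr i
      rw [inv_mul_cancel₀]
      change 0 < r i at this
      have : 0 < x + r i := by linarith
      exact this.ne'
    have c := aux_choi (fun i => Φ (P i)) hE (fun i => x + l i)
      (fun i => by have := hl i; positivity) hsum _ (aux_cfc_herm hBpd.1 _) hG
    have := c.dotProduct_mulVec_nonneg v
    have e := haf (fun t => (x + t)⁻¹)
    simp only [Complex.ofReal_inv] at e
    rw [Matrix.sub_mulVec, dotProduct_sub, hbf, e, ← Complex.ofReal_sub] at this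
    exact sub_nonneg.1 (Complex.zero_le_real.1 this)


lemma aux_cfc_diag {n : Type*} [Fintype n] [DecidableEq n] (l : n → ℝ) (f : ℝ → ℝ) :
    Matrix.cfcReal f (Matrix.diagonal fun i => (l i : ℂ)) =
      Matrix.diagonal fun i => (f (l i) : ℂ) := by
  have hA : (Matrix.diagonal fun i => (l i : ℂ)).IsHermitian := by
    apply Matrix.isHermitian_diagonal_of_self_adjoint
    ext i
    simp
  have hid := aux_cfc_id hA
  rw [aux_cfc_eq hA] at hid ⊢
  have h1 : star (hA.eigenvectorUnitary : Matrix n n ℂ) *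
      (hA.eigenvectorUnitary : Matrix n n ℂ) = 1 := Unitary.coe_star_mul_self _
  have h2 : (hA.eigenvectorUnitary : Matrix n n ℂ) *
      star (hA.eigenvectorUnitary : Matrix n n ℂ) = 1 := Unitary.coe_mul_star_self _
  set U := (hA.eigenvectorUnitary : Matrix n n ℂ)
  set m := hA.eigenvalues
  have e : U * Matrix.diagonal (fun i => (m i : ℂ)) = (Matrix.diagonal fun i => (l i : ℂ)) * U := by
    rw [← hid]
    simp only [Matrix.mul_assoc]
    rw [h1, Matrix.mul_one]
  have e2 : U * Matrix.diagonal (fun i => (f (m i) : ℂ)) =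
      (Matrix.diagonal fun i => (f (l i) : ℂ)) * U := by
    ext i j
    have := congrFun (congrFun e i) j
    rw [Matrix.mul_diagonal, Matrix.diagonal_mul] at this ⊢
    by_cases h : U i j = 0
    · simp [h]
    · have hm : (m j : ℂ) = l i := by
        rw [mul_comm] at this
        exact mul_right_cancel₀ h this
      rw [Complex.ofReal_injective hm, mul_comm]
  rw [e2, Matrix.mul_assoc, h2, Matrix.mul_one]

/-- The measurement map `A ↦ ∑ A i i • E i`. -/
noncomputable def auxMap (E : Fin 3 → Matrix (Fin 2) (Fin 2) ℂ) :
    Matrix (Fin 3) (Fin 3) ℂ →ₗ[ℂ] Matrix (Fin 2) (Fin 2) ℂ where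
  toFun A := ∑ i, A i i • E i
  map_add' A B := by simp [add_smul, Finset.sum_add_distrib]
  map_smul' c A := by simp [Finset.smul_sum, smul_smul]

lemma auxMap_cp (E : Fin 3 → Matrix (Fin 2) (Fin 2) ℂ) (hE : ∀ i, (E i).PosSemidef) :
    IsCompletelyPositive (auxMap E) := by
  intro k M hM
  have : (Matrix.of fun (i j : Fin 2 × Fin k) =>
      auxMap E (Matrix.of fun s t => M (s, i.2) (t, j.2)) i.1 j.1) =
      ∑ s, Matrix.kroneckerMap (fun x y => x * y) (E s)
        (M.submatrix (fun a => (s, a)) (fun a => (s, a))) := by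
    ext i j
    rw [Matrix.sum_apply]
    simp [auxMap, Matrix.sum_apply, mul_comm]
  rw [this]
  refine Matrix.posSemidef_sum _ fun s _ => ?_
  exact (hE s).kronecker (hM.submatrix _)

lemma aux_two (x y z : ℝ) (hx : 0 < x) (hd : 0 < x * z - y ^ 2)
    (B : Matrix (Fin 2) (Fin 2) ℂ) (hB : B = !![(x : ℂ), y; y, z]) :
    ∃ b0 b1 r0 r1 : ℝ, 0 ≤ b0 ∧ 0 ≤ b1 ∧ 0 < r0 ∧ 0 < r1 ∧ b0 + b1 = 1 ∧
      b0 * r0 + b1 * r1 = z ∧ r0 + r1 = x + z ∧ r0 * r1 = x * z - y ^ 2 ∧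
      ∀ f : ℝ → ℝ, Matrix.cfcReal f B 1 1 = ((b0 * f r0 + b1 * f r1 : ℝ) : ℂ) := by
  have hH : B.IsHermitian := by
    rw [hB]
    ext i j
    fin_cases i <;> fin_cases j <;> simp
  obtain ⟨b, hb, hbf⟩ := aux_weights hH (Pi.single 1 1)
  have hf : ∀ f : ℝ → ℝ, Matrix.cfcReal f B 1 1 = ((b 0 * f (hH.eigenvalues 0) + b 1 * f (hH.eigenvalues 1) : ℝ) : ℂ) := by
    intro f
    have := hbf f
    rw [Fin.sum_univ_two] at this
    rw [← this]
    simp [dotProduct, Matrix.mulVec, Fin.sum_univ_two]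
  have ht : hH.eigenvalues 0 + hH.eigenvalues 1 = x + z := by
    have := hH.trace_eq_sum_eigenvalues
    have htr : B.trace = x + z := by rw [hB, Matrix.trace_fin_two]; simp
    rw [Fin.sum_univ_two, htr] at this
    apply Complex.ofReal_injective
    push_cast
    exact this.symm
  have hdet : hH.eigenvalues 0 * hH.eigenvalues 1 = x * z - y ^ 2 := by
    have := hH.det_eq_prod_eigenvalues
    rw [Fin.prod_univ_two] at this
    have h2 : B.det = x * z - y * y := by
      rw [hB, Matrix.det_fin_two]; simp
    rw [h2] at this
    apply Complex.ofReal_injective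
    push_cast
    rw [pow_two]
    exact this.symm
  have hz : 0 < z := by
    by_contra h
    have : x * z ≤ 0 := mul_nonpos_of_nonneg_of_nonpos hx.le (not_lt.1 h)
    nlinarith [sq_nonneg y]
  have hpos : 0 < hH.eigenvalues 0 ∧ 0 < hH.eigenvalues 1 := by
    rw [← hdet] at hd
    rcases pos_and_pos_or_neg_and_neg_of_mul_pos hd with h | h
    · exact h
    · linarith [h.1, h.2]
  refine ⟨b 0, b 1, _, _, hb 0, hb 1, hpos.1, hpos.2, ?_, ?_, ht, hdet, hf⟩
  · have := hf (fun _ => 1)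
    rw [aux_cfc_one hH] at this
    apply Complex.ofReal_injective
    simpa using this.symm
  · have := hf (fun t => t)
    rw [aux_cfc_id hH] at this
    apply Complex.ofReal_injective
    rw [← this, hB]
    simp

/-- consequence of the Jensen inequality for our test family -/
lemma aux_test (p : ℝ)
    (H : ∀ Φ : Matrix (Fin 3) (Fin 3) ℂ →ₗ[ℂ] Matrix (Fin 2) (Fin 2) ℂ,
      Φ 1 = 1 → IsCompletelyPositive Φ →
      ∀ A : Matrix (Fin 3) (Fin 3) ℂ, A.PosDef →
        (Φ (Matrix.rpowH A p) - Matrix.rpowH (Φ A) p).PosSemidef)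
    (r : ℝ) (hr : r ^ 2 < 1) (l0 l1 l2 : ℝ) (h0 : 0 < l0) (h1 : 0 < l1) (h2 : 0 < l2)
    (x y z : ℝ) (hx : x = l0 * (1 - r ^ 2) + r ^ 2 * (l1 + l2) / 2) (hy : y = r * (l2 - l1) / 2)
    (hz : z = (l1 + l2) / 2) :
    ∃ b0 b1 r0 r1 : ℝ, 0 ≤ b0 ∧ 0 ≤ b1 ∧ 0 < r0 ∧ 0 < r1 ∧ b0 + b1 = 1 ∧
      b0 * r0 + b1 * r1 = z ∧ r0 + r1 = x + z ∧ r0 * r1 = x * z - y ^ 2 ∧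
      b0 * r0 ^ p + b1 * r1 ^ p ≤ (l1 ^ p + l2 ^ p) / 2 := by
  have hr' : (0 : ℂ) ≤ ((1 - r ^ 2 : ℝ) : ℂ) := Complex.zero_le_real.2 (by linarith)
  have hh : (0 : ℂ) ≤ ((1 / 2 : ℝ) : ℂ) := Complex.zero_le_real.2 (by norm_num)
  have hE0 : (!![((1 - r ^ 2 : ℝ) : ℂ), 0; 0, 0] : Matrix (Fin 2) (Fin 2) ℂ).PosSemidef := by
    convert (Matrix.posSemidef_vecMulVec_self_star (![1, 0] : Fin 2 → ℂ)).smul hr' using 1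
    ext i j
    rw [Matrix.smul_apply, Matrix.vecMulVec_apply]
    fin_cases i <;> fin_cases j <;> simp
  have hE1 : (!![(r : ℂ) ^ 2 / 2, -r / 2; -r / 2, 1 / 2] :
      Matrix (Fin 2) (Fin 2) ℂ).PosSemidef := by
    convert (Matrix.posSemidef_vecMulVec_self_star (![(r : ℂ), -1] : Fin 2 → ℂ)).smul hh using 1
    ext i j
    rw [Matrix.smul_apply, Matrix.vecMulVec_apply]
    fin_cases i <;> fin_cases j <;> simp <;> ring
  have hE2 : (!![(r : ℂ) ^ 2 / 2, r / 2; r / 2, 1 / 2] :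
      Matrix (Fin 2) (Fin 2) ℂ).PosSemidef := by
    convert (Matrix.posSemidef_vecMulVec_self_star (![(r : ℂ), 1] : Fin 2 → ℂ)).smul hh using 1
    ext i j
    rw [Matrix.smul_apply, Matrix.vecMulVec_apply]
    fin_cases i <;> fin_cases j <;> simp <;> ring
  set E : Fin 3 → Matrix (Fin 2) (Fin 2) ℂ :=
    ![!![((1 - r ^ 2 : ℝ) : ℂ), 0; 0, 0], !![(r : ℂ) ^ 2 / 2, -r / 2; -r / 2, 1 / 2],
      !![(r : ℂ) ^ 2 / 2, r / 2; r / 2, 1 / 2]] with hE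
  have hpsd : ∀ i, (E i).PosSemidef := by
    intro i
    fin_cases i
    · exact hE0
    · exact hE1
    · exact hE2
  have hunit : auxMap E 1 = 1 := by
    ext i j
    fin_cases i <;> fin_cases j <;>
      simp [auxMap, hE, Fin.sum_univ_three] <;> try ring
  set L : Fin 3 → ℝ := ![l0, l1, l2] with hL
  have hPD : (Matrix.diagonal fun i => (L i : ℂ)).PosDef := by
    apply Matrix.PosDef.diagonal
    intro i
    fin_cases i
    · simpa [hL] using h0
    · simpa [hL] using h1
    · simpa [hL] using h2
  have J := H (auxMap E) hunit (auxMap_cp E hpsd) _ hPD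
  have hB : auxMap E (Matrix.diagonal fun i => (L i : ℂ)) = !![(x : ℂ), y; y, z] := by
    rw [hx, hy, hz]
    ext i j
    fin_cases i <;> fin_cases j <;>
      simp [auxMap, hE, hL, Fin.sum_univ_three] <;> try ring
  have hx0 : 0 < x := by
    rw [hx]
    have : 0 < l0 * (1 - r ^ 2) := mul_pos h0 (by linarith)
    positivity
  have hd : 0 < x * z - y ^ 2 := by
    have : x * z - y ^ 2 = l0 * (1 - r ^ 2) * ((l1 + l2) / 2) + r ^ 2 * l1 * l2 := by
      rw [hx, hy, hz]; ring
    rw [this]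
    have : 0 < l0 * (1 - r ^ 2) := mul_pos h0 (by linarith)
    positivity
  obtain ⟨b0, b1, r0, r1, hb0, hb1, hr0, hr1, e1, e2, e3, e4, hf⟩ := aux_two x y z hx0 hd _ hB
  refine ⟨b0, b1, r0, r1, hb0, hb1, hr0, hr1, e1, e2, e3, e4, ?_⟩
  have := J.diag_nonneg (i := 1)
  unfold Matrix.rpowH at this
  rw [Matrix.sub_apply, hf, aux_cfc_diag] at this
  have e : auxMap E (Matrix.diagonal fun i => ((L i ^ p : ℝ) : ℂ)) 1 1 =
      (((l1 ^ p + l2 ^ p) / 2 : ℝ) : ℂ) := by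
    simp [auxMap, hE, hL, Fin.sum_univ_three]; ring
  rw [e, ← Complex.ofReal_sub] at this
  have := Complex.zero_le_real.1 this
  linarith

lemma aux_choose (k : ℝ) (hk : 0 < k) : ∃ u : ℝ, 0 < u ∧ u ≤ 1 ∧ u ^ k = 1 / 800 := by
  refine ⟨(1 / 800 : ℝ) ^ k⁻¹, by positivity, ?_, ?_⟩
  · exact Real.rpow_le_one (by norm_num) (by norm_num) (by positivity)
  · rw [← Real.rpow_mul (by norm_num), inv_mul_cancel₀ hk.ne', Real.rpow_one]

lemma aux_thresh (t k g : ℝ) (ht : 0 < t) (hk : 0 < k) (hg : 0 < g) (hg1 : g ≤ 1) :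
    t ^ k * (g - t) ≤ g ^ k := by
  have h1 : 0 < t ^ k := Real.rpow_pos_of_pos ht k
  have h2 : 0 < g ^ k := Real.rpow_pos_of_pos hg k
  by_cases h : t ≤ g
  · have := Real.rpow_le_rpow ht.le h hk.le
    nlinarith
  · push Not at h
    nlinarith

lemma aux_case1 (p : ℝ) (h0 : 0 < p) (h1 : p < 1)
    (H : ∀ Φ : Matrix (Fin 3) (Fin 3) ℂ →ₗ[ℂ] Matrix (Fin 2) (Fin 2) ℂ,
      Φ 1 = 1 → IsCompletelyPositive Φ →
      ∀ A : Matrix (Fin 3) (Fin 3) ℂ, A.PosDef →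
        (Φ (Matrix.rpowH A p) - Matrix.rpowH (Φ A) p).PosSemidef) : False := by
  obtain ⟨b0, b1, r0, r1, hb0, hb1, hr0, hr1, e1, e2, e3, e4, h⟩ := aux_test p H 0 (by norm_num)
    (5 / 2) 1 4 (by norm_num) (by norm_num) (by norm_num) _ _ _ rfl rfl rfl
  norm_num at e3 e4
  have hsq : (r0 - r1) ^ 2 = 0 := by nlinarith
  have hz := pow_eq_zero_iff (two_ne_zero) |>.1 hsq
  have hr0' : r0 = 5 / 2 := by linarith
  have hr1' : r1 = 5 / 2 := by linarith
  rw [hr0', hr1', ← add_mul, e1, one_mul] at h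
  obtain ⟨_, c⟩ := Real.strictConcaveOn_rpow h0 h1
  have c := c (show (1:ℝ) ∈ Set.Ici 0 by norm_num) (show (4:ℝ) ∈ Set.Ici 0 by norm_num)
    (by norm_num) (show (0:ℝ) < 1 / 2 by norm_num) (show (0:ℝ) < 1 / 2 by norm_num) (by norm_num)
  norm_num at c
  norm_num at h
  linarith

lemma aux_case2 (p : ℝ) (h0 : 2 < p)
    (H : ∀ Φ : Matrix (Fin 3) (Fin 3) ℂ →ₗ[ℂ] Matrix (Fin 2) (Fin 2) ℂ,
      Φ 1 = 1 → IsCompletelyPositive Φ →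
      ∀ A : Matrix (Fin 3) (Fin 3) ℂ, A.PosDef →
        (Φ (Matrix.rpowH A p) - Matrix.rpowH (Φ A) p).PosSemidef) : False := by
  obtain ⟨k, hk, rfl⟩ : ∃ k, 0 < k ∧ p = k + 2 := ⟨p - 2, by linarith, by ring⟩
  obtain ⟨u, hu, hu1, huk⟩ := aux_choose k hk
  obtain ⟨s, hs⟩ : ∃ s, s = u / 128 := ⟨_, rfl⟩
  have hs0 : 0 < s := by rw [hs]; positivity
  have hs1 : s ≤ 1 / 128 := by rw [hs]; linarith
  obtain ⟨b0, b1, r0, r1, hb0, hb1, hr0, hr1, e1, e2, e3, e4, h⟩ := aux_test (k + 2) H (1 / 2)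
    (by norm_num) 1 s (2 * s) (by norm_num) hs0 (by positivity) (3 / 4 + 3 * s / 8) (s / 4)
    (3 * s / 2) (by ring) (by ring) (by ring)
  have q0 : r0 ^ 2 = (r0 + r1) * r0 - r0 * r1 := by ring
  have q1 : r1 ^ 2 = (r0 + r1) * r1 - r0 * r1 := by ring
  rw [e3, e4] at q0 q1
  have m2 : b0 * r0 ^ 2 + b1 * r1 ^ 2 = 37 / 16 * s ^ 2 := by
    rw [q0, q1]
    linear_combination (3 / 4 + 3 * s / 8 + 3 * s / 2) * e2 -
      ((3 / 4 + 3 * s / 8) * (3 * s / 2) - (s / 4) ^ 2) * e1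
  have m3 : b0 * r0 ^ 3 + b1 * r1 ^ 3 = (3 / 4 + 3 * s / 8 + 3 * s / 2) * (37 / 16 * s ^ 2) -
      ((3 / 4 + 3 * s / 8) * (3 * s / 2) - (s / 4) ^ 2) * (3 * s / 2) := by
    linear_combination (3 / 4 + 3 * s / 8 + 3 * s / 2) * m2 -
      ((3 / 4 + 3 * s / 8) * (3 * s / 2) - (s / 4) ^ 2) * e2 + b0 * r0 * q0 + b1 * r1 * q1
  have t0 := aux_thresh (1 / 64) k r0 (by norm_num) hk hr0 (by linarith)
  have t1 := aux_thresh (1 / 64) k r1 (by norm_num) hk hr1 (by linarith)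
  have ek : ∀ g : ℝ, 0 < g → g ^ (k + 2) = g ^ k * g ^ 2 := by
    intro g hg
    rw [Real.rpow_add hg, Real.rpow_two]
  have hT : 0 < (1 / 64 : ℝ) ^ k := by positivity
  have hs2 : (2 * s) ^ k = (1 / 64 : ℝ) ^ k * (1 / 800) := by
    rw [← huk, ← Real.mul_rpow (by norm_num) hu.le, hs]
    congr 1; ring
  have hs3 : s ^ k ≤ (2 * s) ^ k := Real.rpow_le_rpow hs0.le (by linarith) hk.le
  rw [ek _ hr0, ek _ hr1, ek _ hs0, ek _ (by positivity)] at h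
  rw [hs2] at h hs3
  set T := (1 / 64 : ℝ) ^ k
  have a0 : b0 * r0 ^ 2 * (T * (r0 - 1 / 64)) ≤ b0 * r0 ^ 2 * r0 ^ k :=
    mul_le_mul_of_nonneg_left t0 (by positivity)
  have a1 : b1 * r1 ^ 2 * (T * (r1 - 1 / 64)) ≤ b1 * r1 ^ 2 * r1 ^ k :=
    mul_le_mul_of_nonneg_left t1 (by positivity)
  have low : T * (s ^ 2 / 100) ≤ b0 * (r0 ^ k * r0 ^ 2) + b1 * (r1 ^ k * r1 ^ 2) := by
    have m : s ^ 2 / 100 ≤ (b0 * r0 ^ 3 + b1 * r1 ^ 3) - 1 / 64 * (b0 * r0 ^ 2 + b1 * r1 ^ 2) := by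
      rw [m2, m3]
      have : 0 < s ^ 3 := by positivity
      nlinarith [sq_nonneg s]
    have := mul_le_mul_of_nonneg_left m hT.le
    linarith
  have up : s ^ k * s ^ 2 ≤ T * (1 / 800) * s ^ 2 := mul_le_mul_of_nonneg_right hs3 (by positivity)
  have : 0 < T * s ^ 2 := by positivity
  nlinarith

lemma aux_poly (w : ℝ) (h0 : 0 < w) (h1 : w ≤ 1 / 100) :
    0 ≤ (3 + 5 * w - 2 * w ^ 2) * (5 - 2 * w) - 2 * (7 - 3 * w)
      - 1 / 100 * ((5 - 2 * w) * (7 - 3 * w)) - (7 - 3 * w) ^ 2 / 100 := by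
  have a : w ^ 2 ≤ w / 100 := by nlinarith
  have b : 0 < w ^ 3 := by positivity
  ring_nf
  linarith

set_option maxHeartbeats 1000000 in
lemma aux_case3 (p : ℝ) (h0 : p < -1)
    (H : ∀ Φ : Matrix (Fin 3) (Fin 3) ℂ →ₗ[ℂ] Matrix (Fin 2) (Fin 2) ℂ,
      Φ 1 = 1 → IsCompletelyPositive Φ →
      ∀ A : Matrix (Fin 3) (Fin 3) ℂ, A.PosDef →
        (Φ (Matrix.rpowH A p) - Matrix.rpowH (Φ A) p).PosSemidef) : False := by
  obtain ⟨k, hk, rfl⟩ : ∃ k, 0 < k ∧ p = -(k + 1) := ⟨-p - 1, by linarith, by ring⟩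
  obtain ⟨u, hu, hu1, huk⟩ := aux_choose k hk
  obtain ⟨w, hw⟩ : ∃ w, w = u / 100 := ⟨_, rfl⟩
  have hw0 : 0 < w := by rw [hw]; positivity
  have hw1 : w ≤ 1 / 100 := by rw [hw]; linarith
  obtain ⟨r, hr0, hr2⟩ : ∃ r, 0 < r ∧ r ^ 2 = w := ⟨√w, by positivity, Real.sq_sqrt hw0.le⟩
  obtain ⟨b0, b1, r0, r1, hb0, hb1, hr0, hr1, e1, e2, e3, e4, h⟩ := aux_test (-(k + 1)) H r
    (by linarith) 1 w⁻¹ (2 * w⁻¹) (by norm_num) (by positivity) (by positivity) (5 / 2 - w)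
    (r * w⁻¹ / 2) (3 / 2 * w⁻¹) (by rw [hr2]; field_simp; ring) (by ring) (by ring)
  have hd : (5 / 2 - w) * (3 / 2 * w⁻¹) - (r * w⁻¹ / 2) ^ 2 = (7 - 3 * w) / (2 * w) := by
    have : (r * w⁻¹ / 2) ^ 2 = r ^ 2 * w⁻¹ ^ 2 / 4 := by ring
    rw [this, hr2]
    field_simp
    ring
  rw [hd] at e4
  obtain ⟨D, hD⟩ : ∃ D, D = 7 - 3 * w := ⟨_, rfl⟩
  have hD6 : 6 ≤ D := by linarith
  have hD7 : D ≤ 7 := by linarith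
  rw [← hD] at e4
  have i0 : r0⁻¹ = 2 * w / D * r1 := by
    have : D ≠ 0 := by linarith
    field_simp at e4 ⊢
    linarith
  have i1 : r1⁻¹ = 2 * w / D * r0 := by
    have : D ≠ 0 := by linarith
    field_simp at e4 ⊢
    linarith
  have hg0 : 0 < r0⁻¹ := by positivity
  have hg1 : 0 < r1⁻¹ := by positivity
  have ek : ∀ g : ℝ, 0 < g → g ^ (-(k + 1)) = g⁻¹ * g⁻¹ ^ k := by
    intro g hg
    rw [Real.rpow_neg hg.le, ← Real.inv_rpow hg.le, Real.rpow_add (by positivity), Real.rpow_one,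
      mul_comm]
  rw [ek _ hr0, ek _ hr1, ek _ (by positivity), ek _ (by positivity)] at h
  generalize r0⁻¹ = g0 at *
  generalize r1⁻¹ = g1 at *
  have gs : g0 + g1 = (3 + 5 * w - 2 * w ^ 2) / D := by
    have : D ≠ 0 := by linarith
    rw [i0, i1, ← mul_add, add_comm r1, e3]
    field_simp
    ring
  have gp : g0 * g1 = 2 * w / D := by
    have : D ≠ 0 := by linarith
    have : g0 * g1 = (2 * w / D) ^ 2 * (r0 * r1) := by rw [i0, i1]; ring
    rw [this, e4]
    field_simp
  have n1 : b0 * g0 + b1 * g1 = w * (5 - 2 * w) / D := by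
    have : D ≠ 0 := by linarith
    have : b0 * g0 + b1 * g1 = 2 * w / D * ((b0 + b1) * (r0 + r1) - (b0 * r0 + b1 * r1)) := by
      rw [i0, i1]; ring
    rw [this, e1, e2, e3]
    field_simp
    ring
  have n2 : b0 * g0 ^ 2 + b1 * g1 ^ 2 =
      (3 + 5 * w - 2 * w ^ 2) / D * (w * (5 - 2 * w) / D) - 2 * w / D := by
    rw [← gs, ← n1, ← gp]
    linear_combination (-(g0 * g1)) * e1
  have hle : g0 + g1 ≤ 1 := by
    rw [gs, div_le_one (by linarith)]
    nlinarith
  have t0 := aux_thresh (1 / 100) k g0 (by norm_num) hk hg0 (by linarith)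
  have t1 := aux_thresh (1 / 100) k g1 (by norm_num) hk hg1 (by linarith)
  have hT : 0 < (1 / 100 : ℝ) ^ k := by positivity
  have hs2 : w ^ k = (1 / 100 : ℝ) ^ k * (1 / 800) := by
    rw [← huk, ← Real.mul_rpow (by norm_num) hu.le, hw]
    congr 1; ring
  have hs3 : (w / 2) ^ k ≤ w ^ k := Real.rpow_le_rpow (by positivity) (by linarith) hk.le
  have hw2 : (2 * w⁻¹)⁻¹ = w / 2 := by field_simp
  rw [hw2, inv_inv] at h
  rw [hs2] at h hs3
  set T := (1 / 100 : ℝ) ^ k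
  have a0 : b0 * g0 * (T * (g0 - 1 / 100)) ≤ b0 * g0 * g0 ^ k :=
    mul_le_mul_of_nonneg_left t0 (by positivity)
  have a1 : b1 * g1 * (T * (g1 - 1 / 100)) ≤ b1 * g1 * g1 ^ k :=
    mul_le_mul_of_nonneg_left t1 (by positivity)
  have low : T * (w / 100) ≤ b0 * (g0 * g0 ^ k) + b1 * (g1 * g1 ^ k) := by
    have m : w / 100 ≤ (b0 * g0 ^ 2 + b1 * g1 ^ 2) - 1 / 100 * (b0 * g0 + b1 * g1) := by
      rw [n1, n2]
      have hD0 : 0 < D := by linarith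
      have e : (3 + 5 * w - 2 * w ^ 2) / D * (w * (5 - 2 * w) / D) - 2 * w / D
          - 1 / 100 * (w * (5 - 2 * w) / D) - w / 100 =
          w * ((3 + 5 * w - 2 * w ^ 2) * (5 - 2 * w) - 2 * D - 1 / 100 * ((5 - 2 * w) * D)
            - D ^ 2 / 100) / D ^ 2 := by
        field_simp
      rw [← sub_nonneg, e]
      apply div_nonneg _ (by positivity)
      apply mul_nonneg hw0.le
      rw [hD]
      exact aux_poly w hw0 hw1
    have := mul_le_mul_of_nonneg_left m hT.le
    linarith
  have up : w / 2 * (w / 2) ^ k ≤ w / 2 * (T * (1 / 800)) :=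
    mul_le_mul_of_nonneg_left hs3 (by positivity)
  have : 0 < T * w := by positivity
  nlinarith


/-- For a nonzero real `p`, the Jensen inequality `Φ(A)^p ≤ Φ(A^p)` holds for every unital
completely positive linear map `Φ : M₃ → M₂` and every `3 × 3` positive definite complex
matrix `A` if and only if `1 ≤ p ≤ 2` or `-1 ≤ p < 0`. -/
theorem jensen_cp_map_iff (p : ℝ) (hp : p ≠ 0) :
    (∀ Φ : Matrix (Fin 3) (Fin 3) ℂ →ₗ[ℂ] Matrix (Fin 2) (Fin 2) ℂ,
      Φ 1 = 1 → IsCompletelyPositive Φ →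
      ∀ A : Matrix (Fin 3) (Fin 3) ℂ, A.PosDef →
        (Φ (Matrix.rpowH A p) - Matrix.rpowH (Φ A) p).PosSemidef) ↔
    ((1 ≤ p ∧ p ≤ 2) ∨ (-1 ≤ p ∧ p < 0)) := by
  constructor
  · intro H
    by_contra hcon
    rcases lt_or_gt_of_ne hp with h | h
    · by_cases h1 : -1 ≤ p
      · exact hcon (Or.inr ⟨h1, h⟩)
      · exact aux_case3 p (not_le.1 h1) H
    · by_cases h1 : 1 ≤ p
      · by_cases h2 : p ≤ 2
        · exact hcon (Or.inl ⟨h1, h2⟩)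
        · exact aux_case2 p (not_le.1 h2) H
      · exact aux_case1 p h (not_le.1 h1) H
  · intro hp' Φ h1 hcp A hA
    exact aux_forward p hp' Φ h1 (aux_pos Φ hcp) A hA
end

section
/- Let p, q be nonzero real numbers and x, y > 0 be such that x^p + y^p ≠ 2, x^q + y^q ≠ 2 and ((x^p + y^p)/2)^{1/p} ≠ ((x^q + y^q)/2)^{1/q}. For θ ∈ ℝ, let A = diag(1, x) and B_θ = R_θ diag(1, y) R_θᵀ, where R_θ is the 2×2 rotation matrix with first column (cos θ, sin θ) and second column (−sin θ, cos θ). Define the constant C := (1/2)·[ (1−x^p)(1−y^p)/(p(2−x^p−y^p)) − (1−x^q)(1−y^q)/(q(2−x^q−y^q)) ]·[ ((x^q+y^q)/2)^{1/q} − ((x^p+y^p)/2)^{1/p} ] − [ (1−y^p)/(2−x^p−y^p) − (1−y^q)/(2−x^q−y^q) ]²·[ 1 − ((x^p+y^p)/2)^{1/p} ]·[ 1 − ((x^q+y^q)/2)^{1/q} ]. Then det( ((A^q + B_θ^q)/2)^{1/q} − ((A^p + B_θ^p)/2)^{1/p} ) = C·θ² + o(θ²) as θ → 0, i.e., the function θ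 ↦ det( ((A^q + B_θ^q)/2)^{1/q} − ((A^p + B_θ^p)/2)^{1/p} ) − C·θ² is o(θ²) as θ → 0. -/
open scoped ComplexOrder

open Asymptotics Matrix

/-- The `2 × 2` rotation matrix by angle `θ`, as a complex matrix. -/
noncomputable def rotC (θ : ℝ) : Matrix (Fin 2) (Fin 2) ℂ :=
  !![(Real.cos θ : ℂ), -(Real.sin θ : ℂ); (Real.sin θ : ℂ), (Real.cos θ : ℂ)]

/-- The constant `C` in the second-order expansion of Lemma 3.1. -/
noncomputable def lemmaConst (p q x y : ℝ) : ℝ :=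
  (1 / 2) *
      ((1 - x ^ p) * (1 - y ^ p) / (p * (2 - x ^ p - y ^ p)) -
        (1 - x ^ q) * (1 - y ^ q) / (q * (2 - x ^ q - y ^ q))) *
      (((x ^ q + y ^ q) / 2) ^ (1 / q) - ((x ^ p + y ^ p) / 2) ^ (1 / p)) -
    ((1 - y ^ p) / (2 - x ^ p - y ^ p) - (1 - y ^ q) / (2 - x ^ q - y ^ q)) ^ 2 *
      (1 - ((x ^ p + y ^ p) / 2) ^ (1 / p)) * (1 - ((x ^ q + y ^ q) / 2) ^ (1 / q))

lemma cfcReal_affine (f : ℝ → ℝ) (A : Matrix (Fin 2) (Fin 2) ℂ) (hA : A.IsHermitian)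
    (l1 l2 α β : ℝ) (ht : A 0 0 + A 1 1 = (l1 + l2 : ℝ))
    (hd : A 0 0 * A 1 1 - A 0 1 * A 1 0 = (l1 * l2 : ℝ))
    (e1 : f l1 = α + β * l1) (e2 : f l2 = α + β * l2) :
    Matrix.cfcReal f A = (α : ℂ) • (1 : Matrix (Fin 2) (Fin 2) ℂ) + (β : ℂ) • A := by
  have hev : ∀ i, f (hA.eigenvalues i) = α + β * hA.eigenvalues i := by
    have hT := hA.trace_eq_sum_eigenvalues
    have hD := hA.det_eq_prod_eigenvalues
    rw [Matrix.trace_fin_two, ht] at hT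
    rw [Matrix.det_fin_two, hd] at hD
    simp only [Fin.sum_univ_two, Fin.prod_univ_two] at hT hD
    have hT' : l1 + l2 = hA.eigenvalues 0 + hA.eigenvalues 1 := by
      apply Complex.ofReal_injective; push_cast at hT ⊢; exact hT
    have hD' : l1 * l2 = hA.eigenvalues 0 * hA.eigenvalues 1 := by
      apply Complex.ofReal_injective; push_cast at hD ⊢; exact hD
    intro i
    have h0 : (hA.eigenvalues i - l1) * (hA.eigenvalues i - l2) = 0 := by
      fin_cases i
      · simp only [Fin.zero_eta]; linear_combination hD' - hA.eigenvalues 0 * hT'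
      · simp only [Fin.mk_one]; linear_combination hD' - hA.eigenvalues 1 * hT'
    rcases mul_eq_zero.mp h0 with h | h
    · rw [sub_eq_zero.mp h, e1]
    · rw [sub_eq_zero.mp h, e2]
  unfold Matrix.cfcReal
  rw [dif_pos hA]
  have hdiag : Matrix.diagonal (fun i => (f (hA.eigenvalues i) : ℂ))
      = (α : ℂ) • (1 : Matrix (Fin 2) (Fin 2) ℂ) +
        (β : ℂ) • Matrix.diagonal (fun i => (hA.eigenvalues i : ℂ)) := by
    ext i j
    by_cases hij : i = j
    · subst hij; simp [hev]
    · simp [hij]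
  have hU : (hA.eigenvectorUnitary : Matrix (Fin 2) (Fin 2) ℂ) *
      star (hA.eigenvectorUnitary : Matrix (Fin 2) (Fin 2) ℂ) = 1 :=
    Unitary.coe_mul_star_self _
  have hS : A = (hA.eigenvectorUnitary : Matrix (Fin 2) (Fin 2) ℂ) *
      Matrix.diagonal (fun i => (hA.eigenvalues i : ℂ)) *
      star (hA.eigenvectorUnitary : Matrix (Fin 2) (Fin 2) ℂ) := by
    have := hA.spectral_theorem
    rw [Unitary.conjStarAlgAut_apply] at this
    exact this
  rw [hdiag, Matrix.mul_add, Matrix.add_mul]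
  conv_rhs => rw [hS]
  simp only [Matrix.mul_smul, Matrix.smul_mul, Matrix.mul_one, hU]

lemma exists_affine (f : ℝ → ℝ) (y : ℝ) : ∃ α β : ℝ, f 1 = α + β * 1 ∧ f y = α + β * y := by
  by_cases h : y = 1
  · exact ⟨f 1, 0, by simp, by simp [h]⟩
  · have : y - 1 ≠ 0 := sub_ne_zero.mpr h
    refine ⟨f 1 - (f y - f 1) / (y - 1), (f y - f 1) / (y - 1), by ring, ?_⟩
    field_simp; ring

lemma rpowH_diag (x q : ℝ) :
    Matrix.rpowH (Matrix.diagonal ![1, (x : ℂ)]) q = !![1, 0; 0, ((x ^ q : ℝ) : ℂ)] := by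
  obtain ⟨α, β, e1, e2⟩ := exists_affine (fun t => t ^ q) x
  unfold Matrix.rpowH
  rw [cfcReal_affine _ _ _ 1 x α β _ _ e1 e2]
  · simp only [Real.one_rpow] at e1 e2
    have e1' : (1 : ℂ) = α + β := by rw [← Complex.ofReal_add, ← mul_one β, ← e1]; simp
    ext i j
    fin_cases i <;> fin_cases j <;> simp [e2]
    exact e1'.symm
  · ext i j
    fin_cases i <;> fin_cases j <;> simp
  · simp
  · simp

lemma rpowH_rot (y q θ : ℝ) :
    Matrix.rpowH (rotC θ * Matrix.diagonal ![1, (y : ℂ)] * (rotC θ)ᵀ) q =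
      !![((1 - (1 - y ^ q) * Real.sin θ ^ 2 : ℝ) : ℂ),
          (((1 - y ^ q) * (Real.cos θ * Real.sin θ) : ℝ) : ℂ);
        (((1 - y ^ q) * (Real.cos θ * Real.sin θ) : ℝ) : ℂ),
          ((y ^ q + (1 - y ^ q) * Real.sin θ ^ 2 : ℝ) : ℂ)] := by
  obtain ⟨α, β, e1, e2⟩ := exists_affine (fun t => t ^ q) y
  have hcs := Real.sin_sq_add_cos_sq θ
  have hB : rotC θ * Matrix.diagonal ![1, (y : ℂ)] * (rotC θ)ᵀ =
      !![((1 - (1 - y) * Real.sin θ ^ 2 : ℝ) : ℂ),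
          (((1 - y) * (Real.cos θ * Real.sin θ) : ℝ) : ℂ);
        (((1 - y) * (Real.cos θ * Real.sin θ) : ℝ) : ℂ),
          ((y + (1 - y) * Real.sin θ ^ 2 : ℝ) : ℂ)] := by
    have hcs' : (Complex.sin θ) ^ 2 + (Complex.cos θ) ^ 2 = 1 := Complex.sin_sq_add_cos_sq _
    ext i j
    fin_cases i <;> fin_cases j <;>
      simp [rotC, Matrix.mul_apply, Fin.sum_univ_two, Matrix.vecMul_diagonal]
    · linear_combination hcs'
    · ring
    · ring
    · linear_combination y * hcs'
  rw [hB]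
  unfold Matrix.rpowH
  rw [cfcReal_affine _ _ _ 1 y α β _ _ e1 e2]
  · simp only [Real.one_rpow] at e1 e2
    rw [e2]
    have e1' : (1 : ℂ) = α + β := by rw [← Complex.ofReal_add, ← mul_one β, ← e1]; simp
    ext i j
    fin_cases i <;> fin_cases j <;> simp
    · linear_combination (Complex.sin θ ^ 2 - 1) * e1'
    · linear_combination (-(Complex.cos θ * Complex.sin θ)) * e1'
    · linear_combination (-(Complex.cos θ * Complex.sin θ)) * e1'
    · linear_combination (-(Complex.sin θ ^ 2)) * e1'
  · ext i j
    fin_cases i <;> fin_cases j <;> simp [Complex.conj_ofReal, ← Complex.ofReal_sin, ← Complex.ofReal_cos]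
  · simp
  · simp only [Matrix.of_apply, Matrix.cons_val', Matrix.cons_val_zero, Matrix.cons_val_one, Matrix.cons_val_fin_one]
    norm_cast
    linear_combination (-(1 - y) ^ 2 * Real.sin θ ^ 2) * hcs

lemma mean_expansion (p x y : ℝ) (hp : p ≠ 0) (hx : 0 < x) (hy : 0 < y)
    (h1 : x ^ p + y ^ p ≠ 2) :
    ∃ G H K : ℝ → ℝ,
      (∀ᶠ u in nhds (0 : ℝ), ∀ θ : ℝ, Real.sin θ ^ 2 = u →
        Matrix.rpowH ((2 : ℂ)⁻¹ • (Matrix.rpowH (Matrix.diagonal ![1, (x : ℂ)]) p +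
          Matrix.rpowH (rotC θ * Matrix.diagonal ![1, (y : ℂ)] * (rotC θ)ᵀ) p)) (1 / p) =
        !![(G u : ℂ), ((Real.cos θ * Real.sin θ * H u : ℝ) : ℂ);
           ((Real.cos θ * Real.sin θ * H u : ℝ) : ℂ), (K u : ℂ)]) ∧
      HasDerivAt G (-(1 / 2) * ((1 - x ^ p) * (1 - y ^ p) / (p * (2 - x ^ p - y ^ p))) -
        (1 - ((x ^ p + y ^ p) / 2) ^ (1 / p)) * ((1 - y ^ p) / (2 - x ^ p - y ^ p)) ^ 2) 0 ∧
      DifferentiableAt ℝ H 0 ∧ DifferentiableAt ℝ K 0 ∧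
      G 0 = 1 ∧
      H 0 = (1 - ((x ^ p + y ^ p) / 2) ^ (1 / p)) * ((1 - y ^ p) / (2 - x ^ p - y ^ p)) ∧
      K 0 = ((x ^ p + y ^ p) / 2) ^ (1 / p) := by
  have ha : 0 < x ^ p := Real.rpow_pos_of_pos hx p
  have hb : 0 < y ^ p := Real.rpow_pos_of_pos hy p
  simp only [rpowH_diag, rpowH_rot]
  generalize x ^ p = a at *
  generalize y ^ p = b at *
  have hδ : 2 - a - b ≠ 0 := fun h => h1 (by linarith)
  set m : ℝ := (a + b) / 2 with hm
  have hm0 : 0 < m := by positivity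
  have hm1 : 1 - m ≠ 0 := fun h => hδ (by rw [hm] at h; linarith)
  set f : ℝ → ℝ := fun t => t ^ (1 / p) with hf
  set S : ℝ → ℝ := fun u => Real.sqrt (1 - u * ((1 - a) * (1 - b) / (1 - m) ^ 2)) with hS
  have hS0 : S 0 = 1 := by simp [hS]
  have hSd : HasDerivAt S (-((1 - a) * (1 - b) / (1 - m) ^ 2) / 2) 0 := by
    have h := (((hasDerivAt_id (0 : ℝ)).mul_const
      ((1 - a) * (1 - b) / (1 - m) ^ 2)).const_sub 1).sqrt (by simp)
    simpa [hS] using h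
  set L : ℝ → ℝ := fun u => (1 + m + (1 - m) * S u) / 2 with hL
  set N : ℝ → ℝ := fun u => (1 + m - (1 - m) * S u) / 2 with hN
  have hL0 : L 0 = 1 := by simp [hL, hS0]
  have hN0 : N 0 = m := by simp [hN, hS0]
  have hLd : HasDerivAt L (-((1 - a) * (1 - b) / (1 - m)) / 4) 0 := by
    have h := ((hSd.const_mul (1 - m)).const_add (1 + m)).div_const 2
    refine HasDerivAt.congr_deriv h ?_
    field_simp; try ring
  have hNd : DifferentiableAt ℝ N 0 :=
    ((hSd.differentiableAt.const_mul (1 - m)).const_sub (1 + m)).div_const 2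
  have hfL : HasDerivAt (fun u => f (L u)) ((1 / p) * (-((1 - a) * (1 - b) / (1 - m)) / 4)) 0 := by
    have h := hLd.rpow_const (p := 1 / p) (Or.inl (by rw [hL0]; norm_num))
    rw [hL0, Real.one_rpow] at h
    convert h using 1
    ring
  have hfN : DifferentiableAt ℝ (fun u => f (N u)) 0 :=
    hNd.rpow_const (Or.inl (by rw [hN0]; exact hm0.ne'))
  set h : ℝ → ℝ := fun u => (f (L u) - f (N u)) / (L u - N u) with hh
  have hLN : L 0 - N 0 ≠ 0 := by rw [hL0, hN0]; exact hm1
  have hhd : DifferentiableAt ℝ h 0 :=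
    (hfL.differentiableAt.sub hfN).div (hLd.differentiableAt.sub hNd) hLN
  have hf1 : f 1 = 1 := by simp [hf]
  have hh0 : h 0 = (1 - f m) / (1 - m) := by simp only [hh, hL0, hN0, hf1]
  have hmδ : 1 - m = (2 - a - b) / 2 := by rw [hm]; ring
  refine ⟨fun u => f (L u) + h u * (1 - (1 - b) / 2 * u - L u),
    fun u => h u * ((1 - b) / 2),
    fun u => f (L u) + h u * (m + (1 - b) / 2 * u - L u), ?_, ?_, ?_, ?_, ?_, ?_, ?_⟩
  · have hev : ∀ᶠ u in nhds (0 : ℝ), 0 < 1 - u * ((1 - a) * (1 - b) / (1 - m) ^ 2) := by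
      have hc : ContinuousAt (fun u : ℝ => 1 - u * ((1 - a) * (1 - b) / (1 - m) ^ 2)) 0 := by
        fun_prop
      exact hc.eventually (lt_mem_nhds (by simp))
    filter_upwards [hev] with u hu θ hθ
    have hcs := Real.sin_sq_add_cos_sq θ
    have hSpos : 0 < S u := Real.sqrt_pos.mpr hu
    have hSsq : S u ^ 2 = 1 - u * ((1 - a) * (1 - b) / (1 - m) ^ 2) := Real.sq_sqrt hu.le
    have hSsq' : (1 - m) ^ 2 * S u ^ 2 = (1 - m) ^ 2 - u * ((1 - a) * (1 - b)) := by
      rw [hSsq]; field_simp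
    have hLNu : L u - N u ≠ 0 := by
      have : L u - N u = (1 - m) * S u := by simp only [hL, hN]; ring
      rw [this]; exact mul_ne_zero hm1 hSpos.ne'
    have hM : (2 : ℂ)⁻¹ • (!![1, 0; 0, ((a : ℝ) : ℂ)] +
        !![((1 - (1 - b) * Real.sin θ ^ 2 : ℝ) : ℂ),
          (((1 - b) * (Real.cos θ * Real.sin θ) : ℝ) : ℂ);
        (((1 - b) * (Real.cos θ * Real.sin θ) : ℝ) : ℂ),
          ((b + (1 - b) * Real.sin θ ^ 2 : ℝ) : ℂ)]) =
        !![((1 - (1 - b) / 2 * u : ℝ) : ℂ),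
          (((1 - b) / 2 * (Real.cos θ * Real.sin θ) : ℝ) : ℂ);
        (((1 - b) / 2 * (Real.cos θ * Real.sin θ) : ℝ) : ℂ),
          ((m + (1 - b) / 2 * u : ℝ) : ℂ)] := by
      rw [← hθ, hm]
      ext i j
      fin_cases i <;> fin_cases j <;> simp <;> ring
    rw [hM]
    unfold Matrix.rpowH
    rw [cfcReal_affine _ _ _ (L u) (N u) (f (L u) - h u * L u) (h u) _ _ (by simp only [hf]; ring)
      (by
        have : h u * (L u - N u) = f (L u) - f (N u) := by
          simp only [hh]; field_simp
        change f (N u) = _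
        linear_combination this)]
    · ext i j
      fin_cases i <;> fin_cases j <;> simp <;> ring
    · ext i j
      fin_cases i <;> fin_cases j <;> simp [Complex.conj_ofReal, ← Complex.ofReal_sin, ← Complex.ofReal_cos]
    · simp only [Matrix.of_apply, Matrix.cons_val', Matrix.cons_val_zero, Matrix.cons_val_one, Matrix.cons_val_fin_one]
      rw [← Complex.ofReal_add]
      congr 1
      simp only [hL, hN]; ring
    · simp only [Matrix.of_apply, Matrix.cons_val', Matrix.cons_val_zero, Matrix.cons_val_one, Matrix.cons_val_fin_one]
      rw [← Complex.ofReal_mul, ← Complex.ofReal_mul, ← Complex.ofReal_sub]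
      congr 1
      simp only [hL, hN]
      have hc2 : (Real.cos θ * Real.sin θ) ^ 2 = u * (1 - u) := by
        rw [mul_pow, hθ, ← hθ]; linear_combination (Real.sin θ ^ 2) * hcs
      have ea : a = 2 * m - b := by rw [hm]; ring
      rw [ea] at hSsq'
      linear_combination (1 / 4) * hSsq' - ((1 - b) / 2) ^ 2 * hc2
  · have hg := hfL.add (hhd.hasDerivAt.mul
      ((((hasDerivAt_id (0 : ℝ)).const_mul ((1 - b) / 2)).const_sub 1).sub hLd))
    refine HasDerivAt.congr_deriv hg ?_
    simp only [id, Pi.sub_apply, hL0, hh0]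
    change _ = _ - (1 - f m) * _
    rw [hmδ]
    field_simp
    ring
  · exact hhd.mul_const _
  · exact hfL.differentiableAt.add (hhd.mul
      (((differentiableAt_id.const_mul ((1 - b) / 2)).const_add m).sub hLd.differentiableAt))
  · simp [hL0, hf1]
  · change h 0 * _ = (1 - f m) * _
    rw [hh0, hmδ]; field_simp
  · change f (L 0) + h 0 * _ = f m
    rw [hh0, hL0, hf1]; field_simp; ring

/-- Lemma 3.1: with `A = diag(1, x)` and `B_θ = R_θ diag(1, y) R_θᵀ`, one has
`det(((A^q + B_θ^q)/2)^(1/q) − ((A^p + B_θ^p)/2)^(1/p)) = C θ² + o(θ²)` as `θ → 0`. -/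
theorem det_powerMean_difference_expansion (p q x y : ℝ) (hp : p ≠ 0) (hq : q ≠ 0)
    (hx : 0 < x) (hy : 0 < y)
    (h1 : x ^ p + y ^ p ≠ 2) (h2 : x ^ q + y ^ q ≠ 2)
    (h3 : ((x ^ p + y ^ p) / 2) ^ (1 / p) ≠ ((x ^ q + y ^ q) / 2) ^ (1 / q)) :
    (fun θ : ℝ =>
        (Matrix.rpowH ((2 : ℂ)⁻¹ • (Matrix.rpowH (Matrix.diagonal ![1, (x : ℂ)]) q +
              Matrix.rpowH (rotC θ * Matrix.diagonal ![1, (y : ℂ)] * (rotC θ)ᵀ) q)) (1 / q) -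
          Matrix.rpowH ((2 : ℂ)⁻¹ • (Matrix.rpowH (Matrix.diagonal ![1, (x : ℂ)]) p +
              Matrix.rpowH (rotC θ * Matrix.diagonal ![1, (y : ℂ)] * (rotC θ)ᵀ) p)) (1 / p)).det -
        (lemmaConst p q x y : ℂ) * (θ : ℂ) ^ 2)
      =o[nhds (0 : ℝ)] (fun θ : ℝ => θ ^ 2) := by
  obtain ⟨G, H, K, hM, hG, hH, hK, hG0, hH0, hK0⟩ := mean_expansion p x y hp hx hy h1
  obtain ⟨G', H', K', hM', hG', hH', hK', hG0', hH0', hK0'⟩ := mean_expansion q x y hq hx hy h2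
  set Φ : ℝ → ℝ := fun u =>
    (G' u - G u) * (K' u - K u) - u * ((1 - u) * (H' u - H u) ^ 2) with hΦ
  have hΦ0 : Φ 0 = 0 := by simp [hΦ, hG0, hG0']
  have hΦd : HasDerivAt Φ (lemmaConst p q x y) 0 := by
    have hd := ((hG'.sub hG).mul (hK'.sub hK).hasDerivAt).sub ((hasDerivAt_id (0 : ℝ)).mul
      ((differentiableAt_id.const_sub 1).mul ((hH'.sub hH).pow 2)).hasDerivAt)
    refine HasDerivAt.congr_deriv hd ?_
    simp only [id, Pi.sub_apply, Pi.mul_apply, Pi.pow_apply, hG0, hG0', hK0, hK0', hH0, hH0', lemmaConst]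
    ring
  have hs0 : Filter.Tendsto (fun θ : ℝ => Real.sin θ ^ 2) (nhds 0) (nhds 0) := by
    have : Continuous (fun θ : ℝ => Real.sin θ ^ 2) := by fun_prop
    simpa using this.tendsto 0
  have hO : (fun θ : ℝ => Real.sin θ ^ 2) =O[nhds 0] (fun θ : ℝ => θ ^ 2) := by
    refine IsBigO.of_bound 1 (Filter.Eventually.of_forall fun θ => ?_)
    simp only [norm_pow, one_mul, Real.norm_eq_abs]
    exact pow_le_pow_left₀ (abs_nonneg _) Real.abs_sin_le_abs 2
  have ho1 : (fun θ : ℝ => Φ (Real.sin θ ^ 2) - lemmaConst p q x y * Real.sin θ ^ 2)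
      =o[nhds 0] (fun θ : ℝ => θ ^ 2) := by
    have h := (hasDerivAt_iff_isLittleO.mp hΦd).comp_tendsto hs0
    refine IsLittleO.trans_isBigO ?_ hO
    refine (h.congr_left fun θ => ?_).congr_right fun θ => ?_
    · simp [hΦ0]; ring
    · simp
  have ho2 : (fun θ : ℝ => Real.sin θ ^ 2 - θ ^ 2) =o[nhds 0] (fun θ : ℝ => θ ^ 2) := by
    have hs : (fun θ : ℝ => Real.sin θ - θ) =o[nhds 0] (fun θ : ℝ => θ) := by
      have h := hasDerivAt_iff_isLittleO.mp (Real.hasDerivAt_sin 0)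
      simpa using h
    have hs2 : (fun θ : ℝ => Real.sin θ + θ) =O[nhds 0] (fun θ : ℝ => θ) := by
      refine IsBigO.add ?_ (isBigO_refl _ _)
      refine IsBigO.of_bound 1 (Filter.Eventually.of_forall fun θ => ?_)
      simpa using Real.abs_sin_le_abs
    refine ((hs.mul_isBigO hs2).congr_left fun θ => ?_).congr_right fun θ => ?_
    · ring
    · ring
  have ho := ho1.add (ho2.const_mul_left (lemmaConst p q x y))
  rw [← isLittleO_norm_left] at ho ⊢
  refine ho.congr' ?_ Filter.EventuallyEq.rfl
  filter_upwards [hs0.eventually hM, hs0.eventually hM'] with θ e e'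
  rw [e θ rfl, e' θ rfl, ← Complex.norm_real]
  congr 1
  rw [Matrix.det_fin_two]
  simp only [Matrix.sub_apply, Matrix.of_apply, Matrix.cons_val', Matrix.cons_val_zero,
    Matrix.cons_val_one, Matrix.cons_val_fin_one, ← Complex.ofReal_sub, ← Complex.ofReal_mul,
    ← Complex.ofReal_pow]
  congr 1
  simp only [hΦ]
  linear_combination (Real.sin θ ^ 2 * (H' (Real.sin θ ^ 2) - H (Real.sin θ ^ 2)) ^ 2) *
    Real.sin_sq_add_cos_sq θ
end

section
/- Let p, q be real numbers with −1 < p < 1/2, p ≠ 0 and q > max{0, p}. Then there exist 2×2 positive definite complex matrices A, B such that the power mean inequality ((A^p + B^p)/2)^{1/p} ≤ ((A^q + B^q)/2)^{1/q} fails, i.e., ((A^q + B^q)/2)^{1/q} − ((A^p + B^p)/2)^{1/p} is not positive semidefinite. Moreover, A and B can be taken of the form A = diag(1, x) and B = R_θ diag(1, x²) R_θᵀ for suitable x ∈ (0,1) and θ > 0, where R_θ is the 2×2 rotation matrix by angle θ. -/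
open scoped ComplexOrder

open Matrix

theorem ev_two (A : Matrix (Fin 2) (Fin 2) ℂ) (hA : A.IsHermitian)
    (T D : ℝ) (htr : A.trace = (T : ℂ)) (hdet : A.det = (D : ℂ)) :
    T = hA.eigenvalues 0 + hA.eigenvalues 1 ∧ D = hA.eigenvalues 0 * hA.eigenvalues 1 := by
  have h1 := hA.trace_eq_sum_eigenvalues
  have h2 := hA.det_eq_prod_eigenvalues
  rw [htr] at h1
  rw [hdet] at h2
  simp only [Fin.sum_univ_two, Fin.prod_univ_two] at h1 h2
  constructor
  · apply Complex.ofReal_injective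
    rw [h1]
    simp
  · apply Complex.ofReal_injective
    rw [h2]
    simp

theorem cfc_two (f : ℝ → ℝ) (A : Matrix (Fin 2) (Fin 2) ℂ) (hA : A.IsHermitian)
    (a b α β : ℝ) (htr : A.trace = ((a + b : ℝ) : ℂ)) (hdet : A.det = ((a * b : ℝ) : ℂ))
    (ha : f a = α + β * a) (hb : f b = α + β * b) :
    Matrix.cfcReal f A = (α : ℂ) • (1 : Matrix (Fin 2) (Fin 2) ℂ) + (β : ℂ) • A := by
  obtain ⟨h1', h2'⟩ := ev_two A hA _ _ htr hdet
  have key : ∀ i, f (hA.eigenvalues i) = α + β * hA.eigenvalues i := by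
    intro i
    have : (hA.eigenvalues i - a) * (hA.eigenvalues i - b) = 0 := by
      fin_cases i
      · simp only [Fin.zero_eta]
        linear_combination h2' - hA.eigenvalues 0 * h1'
      · simp only [Fin.mk_one]
        linear_combination h2' - hA.eigenvalues 1 * h1'
    rcases mul_eq_zero.mp this with h | h
    · rw [sub_eq_zero.mp h, ha]
    · rw [sub_eq_zero.mp h, hb]
  have hspec := hA.spectral_theorem
  rw [Unitary.conjStarAlgAut_apply] at hspec
  have hU : (hA.eigenvectorUnitary : Matrix (Fin 2) (Fin 2) ℂ) *
      star (hA.eigenvectorUnitary : Matrix (Fin 2) (Fin 2) ℂ) = 1 :=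
    Unitary.mul_star_self_of_mem hA.eigenvectorUnitary.2
  have hd : Matrix.diagonal (fun i => (f (hA.eigenvalues i) : ℂ)) =
      (α : ℂ) • (1 : Matrix (Fin 2) (Fin 2) ℂ) +
        (β : ℂ) • Matrix.diagonal (RCLike.ofReal ∘ hA.eigenvalues) := by
    ext i j
    by_cases hij : i = j
    · subst hij
      simp [key]
    · simp [hij]
  unfold Matrix.cfcReal
  rw [dif_pos hA, hd]
  conv_rhs => rw [hspec]
  rw [Matrix.mul_add, Matrix.add_mul, Matrix.mul_smul, Matrix.smul_mul, Matrix.mul_smul,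
    Matrix.smul_mul, Matrix.mul_one, hU]

/-- real symmetric matrix as a complex matrix -/
noncomputable def symC (a b d : ℝ) : Matrix (Fin 2) (Fin 2) ℂ := !![(a : ℂ), (b : ℂ); (b : ℂ), (d : ℂ)]

theorem symC_herm (a b d : ℝ) : (symC a b d).IsHermitian := by
  ext i j
  fin_cases i <;> fin_cases j <;> simp [symC]

theorem rpow_symC (a b d r l1 l2 α β : ℝ) (htr : a + d = l1 + l2) (hdet : a * d - b * b = l1 * l2)
    (h1 : l1 ^ r = α + β * l1) (h2 : l2 ^ r = α + β * l2) :
    Matrix.rpowH (symC a b d) r = symC (α + β * a) (β * b) (α + β * d) := by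
  unfold Matrix.rpowH
  rw [cfc_two _ _ (symC_herm a b d) l1 l2 α β]
  · ext i j
    fin_cases i <;> fin_cases j <;> simp [symC]
  · rw [← htr]; simp [symC, Matrix.trace_fin_two]
  · rw [← hdet]; simp [symC, Matrix.det_fin_two]
  · exact h1
  · exact h2

theorem diag_eq (x : ℝ) : Matrix.diagonal ![1, (x : ℂ)] = symC 1 0 x := by
  ext i j
  fin_cases i <;> fin_cases j <;> simp [symC]

theorem rot_eq (x θ : ℝ) : rotC θ * Matrix.diagonal ![1, (x : ℂ) ^ 2] * (rotC θ)ᵀ =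
    symC (1 - Real.sin θ ^ 2 * (1 - x ^ 2)) (Real.sin θ * Real.cos θ * (1 - x ^ 2))
      (x ^ 2 + Real.sin θ ^ 2 * (1 - x ^ 2)) := by
  have h : (Complex.sin θ) ^ 2 + Complex.cos θ ^ 2 = 1 := Complex.sin_sq_add_cos_sq _
  ext i j
  fin_cases i <;> fin_cases j <;>
    simp [symC, rotC, Matrix.mul_apply, Fin.sum_univ_two, Matrix.vecMul_diagonal]
  · linear_combination h
  · ring
  · ring
  · linear_combination (x:ℂ)^2 * h

theorem diag_rpow (x r : ℝ) (hx0 : 0 < x) (hx1 : x < 1) :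
    Matrix.rpowH (symC 1 0 x) r = symC 1 0 (x ^ r) := by
  have hx : 1 - x ≠ 0 := by linarith
  rw [rpow_symC 1 0 x r 1 x (1 - (1 - x ^ r) / (1 - x)) ((1 - x ^ r) / (1 - x)) (by ring) (by ring)
    (by simp) (by field_simp; ring)]
  congr 1
  · ring
  · ring
  · field_simp; ring

theorem rot_rpow (x r θ : ℝ) (hx0 : 0 < x) (hx1 : x < 1) :
    Matrix.rpowH (symC (1 - Real.sin θ ^ 2 * (1 - x ^ 2)) (Real.sin θ * Real.cos θ * (1 - x ^ 2))
      (x ^ 2 + Real.sin θ ^ 2 * (1 - x ^ 2))) r =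
    symC (1 - Real.sin θ ^ 2 * (1 - (x ^ r) ^ 2)) (Real.sin θ * Real.cos θ * (1 - (x ^ r) ^ 2))
      ((x ^ r) ^ 2 + Real.sin θ ^ 2 * (1 - (x ^ r) ^ 2)) := by
  have hx : 1 - x ^ 2 ≠ 0 := by nlinarith
  have hxr : (x ^ 2) ^ r = (x ^ r) ^ 2 := by
    rw [← Real.rpow_natCast x 2, ← Real.rpow_natCast (x ^ r) 2, ← Real.rpow_mul hx0.le,
      ← Real.rpow_mul hx0.le, mul_comm]
  have hc : Real.cos θ ^ 2 = 1 - Real.sin θ ^ 2 := by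
    linarith [Real.sin_sq_add_cos_sq θ]
  rw [rpow_symC _ _ _ r 1 (x ^ 2) (1 - (1 - (x ^ r) ^ 2) / (1 - x ^ 2))
    ((1 - (x ^ r) ^ 2) / (1 - x ^ 2)) (by ring)
    (by linear_combination (- Real.sin θ ^ 2 * (1 - x ^ 2) ^ 2) * hc)
    (by simp) (by rw [hxr]; field_simp; ring)]
  congr 1
  · field_simp; ring
  · field_simp
  · field_simp; ring

theorem symC_posDef (a b d : ℝ) (ha : 0 < a) (h : 0 < a * d - b * b) : (symC a b d).PosDef := by
  obtain ⟨h1, h2⟩ := ev_two _ (symC_herm a b d) (a + d) (a * d - b * b)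
    (by simp [symC, Matrix.trace_fin_two]) (by simp [symC, Matrix.det_fin_two])
  have hd : 0 < d := by
    by_contra hd
    nlinarith [mul_self_nonneg b]
  rw [(symC_herm a b d).posDef_iff_eigenvalues_pos]
  have hT : 0 < a + d := by linarith
  rw [h1] at hT
  rw [h2] at h
  intro i
  rcases mul_pos_iff.mp h with h' | h'
  · fin_cases i
    · exact h'.1
    · exact h'.2
  · linarith [h'.1, h'.2]

/-- the quantity `w` -/
noncomputable def wF (L u : ℝ) : ℝ := √(1 - 4 * u * (L * (1 - L)))
noncomputable def l1F (L m u : ℝ) : ℝ := m + (1 - m) * ((1 + wF L u) / 2)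
noncomputable def l2F (L m u : ℝ) : ℝ := m + (1 - m) * ((1 - wF L u) / 2)
noncomputable def bF (L m e u : ℝ) : ℝ := (l1F L m u ^ e - l2F L m u ^ e) / ((1 - m) * wF L u)
noncomputable def aF (L m e u : ℝ) : ℝ := l2F L m u ^ e - bF L m e u * l2F L m u
noncomputable def F11 (L m e u : ℝ) : ℝ := aF L m e u + bF L m e u * (1 - u * (L * (1 - m)))
noncomputable def F22 (L m e u : ℝ) : ℝ := aF L m e u + bF L m e u * (m + u * (L * (1 - m)))
noncomputable def F12 (L m e u : ℝ) : ℝ := bF L m e u * (L * (1 - m))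

theorem F_rpow (L m e θ : ℝ) (hm1 : m ≠ 1)
    (hu : Real.sin θ ^ 2 < 1) :
    Matrix.rpowH (symC (1 - Real.sin θ ^ 2 * (L * (1 - m))) (Real.sin θ * Real.cos θ * (L * (1 - m)))
      (m + Real.sin θ ^ 2 * (L * (1 - m)))) e =
    symC (F11 L m e (Real.sin θ ^ 2)) (Real.sin θ * Real.cos θ * F12 L m e (Real.sin θ ^ 2))
      (F22 L m e (Real.sin θ ^ 2)) := by
  have hc : Real.cos θ ^ 2 = 1 - Real.sin θ ^ 2 := by
    linarith [Real.sin_sq_add_cos_sq θ]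
  have hw0 : 0 < 1 - 4 * Real.sin θ ^ 2 * (L * (1 - L)) := by
    nlinarith [sq_nonneg (2 * L - 1), sq_nonneg (Real.sin θ), mul_nonneg (sq_nonneg (Real.sin θ)) (sq_nonneg (2 * L - 1))]
  have hw : 0 < wF L (Real.sin θ ^ 2) := Real.sqrt_pos.mpr hw0
  have hw2 : wF L (Real.sin θ ^ 2) ^ 2 = 1 - 4 * Real.sin θ ^ 2 * (L * (1 - L)) := Real.sq_sqrt hw0.le
  have hm : 1 - m ≠ 0 := fun h => hm1 (by linarith)
  rw [rpow_symC _ _ _ e (l1F L m (Real.sin θ ^ 2)) (l2F L m (Real.sin θ ^ 2))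
    (aF L m e (Real.sin θ ^ 2)) (bF L m e (Real.sin θ ^ 2))]
  · rw [F11, F12, F22]; congr 1; ring
  · unfold l1F l2F; ring
  · unfold l1F l2F
    linear_combination (- Real.sin θ ^ 2 * (L * (1 - m)) ^ 2) * hc + (1 - m) ^ 2 / 4 * hw2
  · have : l1F L m (Real.sin θ ^ 2) - l2F L m (Real.sin θ ^ 2) = (1 - m) * wF L (Real.sin θ ^ 2) := by
      unfold l1F l2F; ring
    have h2 : bF L m e (Real.sin θ ^ 2) * ((1 - m) * wF L (Real.sin θ ^ 2)) =
        l1F L m (Real.sin θ ^ 2) ^ e - l2F L m (Real.sin θ ^ 2) ^ e := by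
      unfold bF; field_simp
    unfold aF
    linear_combination -(bF L m e (Real.sin θ ^ 2)) * this - h2
  · unfold aF; ring

theorem wF_zero (L : ℝ) : wF L 0 = 1 := by simp [wF]
theorem l1F_zero (L m : ℝ) : l1F L m 0 = 1 := by simp [l1F, wF_zero]
theorem l2F_zero (L m : ℝ) : l2F L m 0 = m := by simp [l2F, wF_zero]
theorem bF_zero (L m e : ℝ) : bF L m e 0 = (1 - m ^ e) / (1 - m) := by
  simp [bF, wF_zero, l1F_zero, l2F_zero]

theorem wF_deriv (L : ℝ) : HasDerivAt (wF L) (-2 * (L * (1 - L))) 0 := by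
  have h : HasDerivAt (fun u : ℝ => 1 - 4 * u * (L * (1 - L))) (- (4 * 1 * (L * (1 - L)))) 0 :=
    (((hasDerivAt_id (0 : ℝ)).const_mul 4).mul_const (L * (1 - L))).const_sub 1
  have := h.sqrt (by norm_num)
  refine this.congr_deriv ?_
  simp; ring

theorem l1F_deriv (L m : ℝ) : HasDerivAt (l1F L m) (- ((1 - m) * (L * (1 - L)))) 0 := by
  have := ((((wF_deriv L).const_add 1).div_const 2).const_mul (1 - m)).const_add m
  refine this.congr_deriv ?_
  ring

theorem l2F_deriv (L m : ℝ) : HasDerivAt (l2F L m) ((1 - m) * (L * (1 - L))) 0 := by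
  have := ((((wF_deriv L).const_sub 1).div_const 2).const_mul (1 - m)).const_add m
  refine this.congr_deriv ?_
  ring

theorem l1p_deriv (L m e : ℝ) :
    HasDerivAt (fun u => l1F L m u ^ e) (- ((1 - m) * (L * (1 - L)) * e)) 0 := by
  have := (l1F_deriv L m).rpow_const (p := e) (Or.inl (by rw [l1F_zero]; norm_num))
  refine this.congr_deriv ?_
  rw [l1F_zero]; simp

theorem l2p_deriv (L m e : ℝ) (hm : 0 < m) :
    HasDerivAt (fun u => l2F L m u ^ e) ((1 - m) * (L * (1 - L)) * e * m ^ (e - 1)) 0 := by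
  have := (l2F_deriv L m).rpow_const (p := e) (Or.inl (by rw [l2F_zero]; exact hm.ne'))
  refine this.congr_deriv ?_
  rw [l2F_zero]

theorem bF_diff (L m e : ℝ) (hm : 0 < m) (hm1 : m ≠ 1) : DifferentiableAt ℝ (bF L m e) 0 := by
  have hm' : 1 - m ≠ 0 := fun h => hm1 (by linarith)
  refine ((l1p_deriv L m e).differentiableAt.sub (l2p_deriv L m e hm).differentiableAt).div
    ((wF_deriv L).differentiableAt.const_mul _) ?_
  rw [wF_zero]; simpa using hm'

theorem F11_deriv (L m e : ℝ) (hm : 0 < m) (hm1 : m ≠ 1) :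
    HasDerivAt (F11 L m e) (- ((1 - m) * (L * (1 - L)) * e) - L ^ 2 * (1 - m ^ e)) 0 := by
  have hm' : 1 - m ≠ 0 := fun h => hm1 (by linarith)
  -- rewrite through l1
  have hev : F11 L m e =ᶠ[nhds 0] fun u => l1F L m u ^ e +
      bF L m e u * ((1 - u * (L * (1 - m))) - l1F L m u) := by
    have hw : ∀ᶠ u in nhds (0 : ℝ), 0 < wF L u := by
      have := (wF_deriv L).continuousAt.tendsto
      rw [wF_zero] at this
      exact this.eventually (lt_mem_nhds one_pos)
    filter_upwards [hw] with u hu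
    have h2 : bF L m e u * ((1 - m) * wF L u) = l1F L m u ^ e - l2F L m u ^ e := by
      unfold bF; field_simp
    have h1 : l1F L m u - l2F L m u = (1 - m) * wF L u := by
      unfold l1F l2F; ring
    unfold F11 aF
    linear_combination h2 - (bF L m e u) * (h1.symm)
  refine HasDerivAt.congr_of_eventuallyEq ?_ hev
  have h3 : HasDerivAt (fun u => (1 - u * (L * (1 - m))) - l1F L m u)
      (- (1 * (L * (1 - m))) - - ((1 - m) * (L * (1 - L)))) 0 :=
    (((hasDerivAt_id (0 : ℝ)).mul_const _).const_sub 1).sub (l1F_deriv L m)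
  have := (l1p_deriv L m e).add ((bF_diff L m e hm hm1).hasDerivAt.mul h3)
  refine this.congr_deriv ?_
  simp only [bF_zero, l1F_zero]
  field_simp
  ring

theorem F11_zero (L m e : ℝ) (hm1 : m ≠ 1) : F11 L m e 0 = 1 := by
  have hm' : 1 - m ≠ 0 := fun h => hm1 (by linarith)
  simp only [F11, aF, bF_zero, l2F_zero]
  field_simp
  ring

theorem F22_zero (L m e : ℝ) : F22 L m e 0 = m ^ e := by
  simp only [F22, aF, bF_zero, l2F_zero]
  ring

theorem F12_zero (L m e : ℝ) (hm1 : m ≠ 1) : F12 L m e 0 = L * (1 - m ^ e) := by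
  have hm' : 1 - m ≠ 0 := fun h => hm1 (by linarith)
  simp only [F12, bF_zero]
  field_simp

theorem F22_diff (L m e : ℝ) (hm : 0 < m) (hm1 : m ≠ 1) : DifferentiableAt ℝ (F22 L m e) 0 := by
  have hb := bF_diff L m e hm hm1
  have h1 := (l2p_deriv L m e hm).differentiableAt
  have h2 := (l2F_deriv L m).differentiableAt
  unfold F22 aF
  fun_prop

theorem F12_diff (L m e : ℝ) (hm : 0 < m) (hm1 : m ≠ 1) : DifferentiableAt ℝ (F12 L m e) 0 :=
  (bF_diff L m e hm hm1).mul_const _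

theorem exists_u (L m e L' m' e' : ℝ) (hm : 0 < m) (hm1 : m ≠ 1) (hm' : 0 < m') (hm1' : m' ≠ 1)
    (h : (- ((1 - m) * (L * (1 - L)) * e) - L ^ 2 * (1 - m ^ e) -
      (- ((1 - m') * (L' * (1 - L')) * e') - L' ^ 2 * (1 - m' ^ e'))) * (m ^ e - m' ^ e') <
      (L * (1 - m ^ e) - L' * (1 - m' ^ e')) ^ 2) :
    ∃ u : ℝ, 0 < u ∧ u < 1 ∧ (F11 L m e u - F11 L' m' e' u) * (F22 L m e u - F22 L' m' e' u) -
      u * (1 - u) * (F12 L m e u - F12 L' m' e' u) ^ 2 < 0 := by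
  have h1 := (F11_deriv L m e hm hm1).sub (F11_deriv L' m' e' hm' hm1')
  have h2 := ((F22_diff L m e hm hm1).sub (F22_diff L' m' e' hm' hm1')).hasDerivAt
  have h3 := ((F12_diff L m e hm hm1).sub (F12_diff L' m' e' hm' hm1')).hasDerivAt
  have h4 : HasDerivAt (fun u : ℝ => u * (1 - u)) (1 * (1 - 0) + 0 * (-1)) 0 :=
    (hasDerivAt_id (0 : ℝ)).mul ((hasDerivAt_id (0 : ℝ)).const_sub 1)
  have h5 := (h1.mul h2).sub (h4.mul (h3.pow 2))
  obtain ⟨D, hD, hDn⟩ : ∃ D, HasDerivAt _ D 0 ∧ D < 0 := ⟨_, h5, by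
    simp only [Pi.sub_apply, F11_zero _ _ _ hm1, F11_zero _ _ _ hm1', F22_zero, F12_zero _ _ _ hm1,
      F12_zero _ _ _ hm1', Pi.pow_apply]
    linarith⟩
  have hneg := hD.tendsto_slope_zero_right.eventually (gt_mem_nhds hDn)
  have hlt : ∀ᶠ u in nhdsWithin (0 : ℝ) (Set.Ioi 0), u < 1 :=
    nhdsWithin_le_nhds (gt_mem_nhds one_pos)
  obtain ⟨u, hu, hu1, hu0⟩ := (hneg.and (hlt.and self_mem_nhdsWithin)).exists
  have hu0 : 0 < u := hu0
  refine ⟨u, hu0, hu1, ?_⟩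
  simp only [Pi.sub_apply, Pi.mul_apply, Pi.pow_apply, F11_zero _ _ _ hm1, F11_zero _ _ _ hm1', zero_add, smul_eq_mul, sub_self,
    zero_mul, sub_zero] at hu
  by_contra hcon
  push Not at hcon
  exact absurd hu (not_lt.mpr (mul_nonneg (inv_nonneg.mpr hu0.le) hcon))

open Filter Topology

theorem tend_rpow (r : ℝ) (hr : 0 < r) :
    Tendsto (fun x : ℝ => x ^ r) (𝓝[>] 0) (𝓝 0) := by
  have := (Real.continuousAt_rpow_const 0 r (Or.inr hr.le)).tendsto
  rw [Real.zero_rpow hr.ne'] at this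
  exact this.mono_left nhdsWithin_le_nhds

/-- `L` as a function of `x, r` -/
noncomputable def LL (r x : ℝ) : ℝ := (1 + x ^ r) / (2 + x ^ r)
noncomputable def mm (r x : ℝ) : ℝ := (x ^ r + (x ^ r) ^ 2) / 2

theorem mm_pos (r x : ℝ) (hx : 0 < x) : 0 < mm r x := by
  have := Real.rpow_pos_of_pos hx r
  unfold mm; positivity

theorem mm_ne (r x : ℝ) (hr : r ≠ 0) (hx : 0 < x) (hx1 : x < 1) : mm r x ≠ 1 := by
  have h := Real.rpow_pos_of_pos hx r
  have h1 : x ^ r ≠ 1 := by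
    rcases lt_or_gt_of_ne hr with h' | h'
    · exact (Real.one_lt_rpow_of_pos_of_lt_one_of_neg hx hx1 h').ne'
    · exact (Real.rpow_lt_one hx.le hx1 h').ne
  intro h2
  unfold mm at h2
  have : (x ^ r - 1) * (x ^ r + 2) = 0 := by linarith
  rcases mul_eq_zero.mp this with h3 | h3
  · exact h1 (by linarith)
  · linarith

theorem mm_one_sub (r x : ℝ) (hx : 0 < x) : LL r x * (1 - mm r x) = (1 - (x ^ r) ^ 2) / 2 := by
  have := Real.rpow_pos_of_pos hx r
  unfold LL mm
  field_simp
  ring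

/-- limit of `mm^(1/r)/x` for positive `r` -/
theorem mu_eq (r x : ℝ) (hr : r ≠ 0) (hx : 0 < x) :
    mm r x ^ (1 / r) = x * ((1 + x ^ r) / 2) ^ (1 / r) := by
  have := Real.rpow_pos_of_pos hx r
  have h : mm r x = x ^ r * ((1 + x ^ r) / 2) := by unfold mm; ring
  rw [h, Real.mul_rpow this.le (by positivity), ← Real.rpow_mul hx.le]
  rw [mul_one_div_cancel hr, Real.rpow_one]

theorem mu_eq_neg (r x : ℝ) (hr : r ≠ 0) (hx : 0 < x) :
    mm r x ^ (1 / r) = x ^ 2 * ((1 + x ^ (-r)) / 2) ^ (1 / r) := by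
  have := Real.rpow_pos_of_pos hx r
  have h' := Real.rpow_pos_of_pos hx (-r)
  have h : mm r x = (x ^ r) ^ 2 * ((1 + x ^ (-r)) / 2) := by
    unfold mm; rw [Real.rpow_neg hx.le]; field_simp; ring
  rw [h, Real.mul_rpow (by positivity) (by positivity)]
  congr 1
  rw [← Real.rpow_natCast (x ^ r) 2, ← Real.rpow_mul hx.le, ← Real.rpow_mul hx.le,
    mul_right_comm, mul_one_div_cancel hr, one_mul, Real.rpow_natCast]

theorem tend_C (r e : ℝ) (hr : 0 < r) :
    Tendsto (fun x : ℝ => ((1 + x ^ r) / 2) ^ e) (𝓝[>] 0) (𝓝 ((1 / 2 : ℝ) ^ e)) := by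
  have h : Tendsto (fun x : ℝ => (1 + x ^ r) / 2) (𝓝[>] 0) (𝓝 ((1 + 0) / 2)) :=
    ((tend_rpow r hr).const_add 1).div_const 2
  rw [add_zero] at h
  exact h.rpow_const (Or.inl (by norm_num))

theorem tend_L (r : ℝ) (hr : 0 < r) : Tendsto (LL r) (𝓝[>] 0) (𝓝 (1 / 2)) := by
  have h : Tendsto (LL r) (𝓝[>] 0) (𝓝 ((1 + 0) / (2 + 0))) :=
    ((tend_rpow r hr).const_add 1).div ((tend_rpow r hr).const_add 2) (by norm_num)
  simpa using h

theorem tend_m (r : ℝ) (hr : 0 < r) : Tendsto (mm r) (𝓝[>] 0) (𝓝 0) := by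
  have h : Tendsto (mm r) (𝓝[>] 0) (𝓝 ((0 + 0 ^ 2) / 2)) :=
    ((tend_rpow r hr).add ((tend_rpow r hr).pow 2)).div_const 2
  simpa using h

theorem tend_id : Tendsto (fun x : ℝ => x) (𝓝[>] 0) (𝓝 0) :=
  tendsto_id.mono_left nhdsWithin_le_nhds

theorem tend_mu (r : ℝ) (hr : 0 < r) : Tendsto (fun x => mm r x ^ (1 / r)) (𝓝[>] 0) (𝓝 0) := by
  have h := tend_id.mul (tend_C r (1 / r) hr)
  rw [zero_mul] at h
  refine h.congr' ?_
  filter_upwards [self_mem_nhdsWithin] with x hx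
  rw [mu_eq r x hr.ne' hx]

noncomputable def dd (r x : ℝ) : ℝ :=
  - ((1 - mm r x) * (LL r x * (1 - LL r x)) * (1 / r)) - LL r x ^ 2 * (1 - mm r x ^ (1 / r))

theorem tend_dd (r : ℝ) (hr : 0 < r) : ∃ c, Tendsto (dd r) (𝓝[>] 0) (𝓝 c) := by
  have hL := tend_L r hr
  exact ⟨_, ((((tend_m r hr).const_sub 1).mul (hL.mul (hL.const_sub 1))).mul_const (1 / r)).neg.sub
    ((hL.pow 2).mul ((tend_mu r hr).const_sub 1))⟩

theorem exists_x_pos (p q : ℝ) (hp : 0 < p) (hp2 : p < 1 / 2) (hpq : p < q) :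
    ∀ᶠ x in 𝓝[>] (0 : ℝ), (dd q x - dd p x) * (mm q x ^ (1 / q) - mm p x ^ (1 / p)) <
      (LL q x * (1 - mm q x ^ (1 / q)) - LL p x * (1 - mm p x ^ (1 / p))) ^ 2 := by
  have hq : 0 < q := hp.trans hpq
  obtain ⟨cp, hcp⟩ := tend_dd p hp
  obtain ⟨cq, hcq⟩ := tend_dd q hq
  have hCp := tend_C p (1 / p) hp
  have hCq := tend_C q (1 / q) hq
  have hl := ((hcq.sub hcp).mul (hCq.sub hCp)).mul (tend_rpow (1 - 2 * p) (by linarith))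
  rw [mul_zero] at hl
  have hr0 : Tendsto (fun x : ℝ => (x ^ (q - p) - 1) / ((2 + x ^ q) * (2 + x ^ p)) -
      x ^ (1 - p) * (LL q x * ((1 + x ^ q) / 2) ^ (1 / q) - LL p x * ((1 + x ^ p) / 2) ^ (1 / p)))
      (𝓝[>] 0) (𝓝 ((0 - 1) / ((2 + 0) * (2 + 0)) - 0 * (1 / 2 * (1 / 2) ^ (1 / q) - 1 / 2 * (1 / 2) ^ (1 / p)))) :=
    (((tend_rpow (q - p) (by linarith)).sub_const 1).div
      (((tend_rpow q hq).const_add 2).mul ((tend_rpow p hp).const_add 2)) (by norm_num)).sub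
      ((tend_rpow (1 - p) (by linarith)).mul
        (((tend_L q hq).mul hCq).sub ((tend_L p hp).mul hCp)))
  have hr := hr0.pow 2
  have hlt := hl.eventually_lt hr (by norm_num)
  filter_upwards [hlt, self_mem_nhdsWithin] with x h hx
  have hx : 0 < x := hx
  have hP := Real.rpow_pos_of_pos hx p
  have hQ := Real.rpow_pos_of_pos hx q
  have e1 : x ^ (1 - 2 * p) * (x ^ p) ^ 2 = x := by
    rw [← Real.rpow_natCast (x ^ p) 2, ← Real.rpow_mul hx.le, ← Real.rpow_add hx]
    convert Real.rpow_one x using 2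
    push_cast; ring
  have e2 : x ^ (1 - p) * x ^ p = x := by
    rw [← Real.rpow_add hx]; simp
  have e3 : x ^ (q - p) * x ^ p = x ^ q := by
    rw [← Real.rpow_add hx]; simp
  have h' := mul_lt_mul_of_pos_right h (pow_pos hP 2)
  rw [mu_eq p x hp.ne' hx, mu_eq q x hq.ne' hx]
  refine lt_of_eq_of_lt ?_ (lt_of_lt_of_eq h' ?_)
  · linear_combination (-(dd q x - dd p x) * (((1 + x ^ q) / 2) ^ (1 / q) - ((1 + x ^ p) / 2) ^ (1 / p))) * e1
  · rw [← mul_pow]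
    congr 1
    have e4 : (x ^ (q - p) - 1) / ((2 + x ^ q) * (2 + x ^ p)) * x ^ p = LL q x - LL p x := by
      rw [div_mul_eq_mul_div, sub_mul, e3]
      unfold LL
      field_simp
      ring
    linear_combination e4 - (LL q x * ((1 + x ^ q) / 2) ^ (1 / q) - LL p x * ((1 + x ^ p) / 2) ^ (1 / p)) * e2

theorem exists_x_neg (p q : ℝ) (hp1 : -1 < p) (hp : p < 0) (hq : 0 < q) :
    ∀ᶠ x in 𝓝[>] (0 : ℝ), (dd q x - dd p x) * (mm q x ^ (1 / q) - mm p x ^ (1 / p)) <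
      (LL q x * (1 - mm q x ^ (1 / q)) - LL p x * (1 - mm p x ^ (1 / p))) ^ 2 := by
  obtain ⟨cq, hcq⟩ := tend_dd q hq
  have hnp : 0 < -p := by linarith
  have hCp := tend_C (-p) (1 / p) hnp
  have hCq := tend_C q (1 / q) hq
  have hT := tend_rpow (-p) hnp
  have hLp : Tendsto (LL p) (𝓝[>] 0) (𝓝 1) := by
    have : Tendsto (fun x : ℝ => (x ^ (-p) + 1) / (2 * x ^ (-p) + 1)) (𝓝[>] 0)
        (𝓝 ((0 + 1) / (2 * 0 + 1))) :=
      (hT.add_const 1).div ((hT.const_mul 2).add_const 1) (by norm_num)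
    rw [show ((0 + 1) / (2 * 0 + 1) : ℝ) = 1 by norm_num] at this
    refine this.congr' ?_
    filter_upwards [self_mem_nhdsWithin] with x hx
    have hx : 0 < x := hx
    have hP := Real.rpow_pos_of_pos hx p
    rw [Real.rpow_neg hx.le]
    unfold LL
    field_simp
  have hmup : Tendsto (fun x => mm p x ^ (1 / p)) (𝓝[>] 0) (𝓝 0) := by
    have h := (tend_id.pow 2).mul hCp
    rw [zero_pow two_ne_zero, zero_mul] at h
    refine h.congr' ?_
    filter_upwards [self_mem_nhdsWithin] with x hx
    rw [mu_eq_neg p x hp.ne hx]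
  have hr := (((tend_L q hq).mul ((tend_mu q hq).const_sub 1)).sub
    (hLp.mul (hmup.const_sub 1))).pow 2
  -- `x * dd p x` tends to zero
  have hdd : Tendsto (fun x => x * dd p x) (𝓝[>] 0) (𝓝 0) := by
    have : Tendsto (fun x : ℝ => - (x ^ (1 + p) * (((x ^ (-p)) ^ 2 - 1) / (2 * x ^ (-p) + 1) / 2) * (1 / p)) -
        x * (LL p x ^ 2 * (1 - mm p x ^ (1 / p)))) (𝓝[>] 0) (𝓝 0) := by
      have h1 : Tendsto (fun x : ℝ => x ^ (1 + p) * (((x ^ (-p)) ^ 2 - 1) / (2 * x ^ (-p) + 1) / 2) * (1 / p))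
          (𝓝[>] 0) (𝓝 (0 * ((0 ^ 2 - 1) / (2 * 0 + 1) / 2) * (1 / p))) :=
        ((tend_rpow (1 + p) (by linarith)).mul ((((hT.pow 2).sub_const 1).div
          ((hT.const_mul 2).add_const 1) (by norm_num)).div_const 2)).mul_const _
      have h2 := tend_id.mul ((hLp.pow 2).mul (hmup.const_sub 1))
      have h3 := h1.neg.sub h2
      simp only [zero_mul, neg_zero, sub_zero] at h3
      refine h3.congr ?_
      intro x
      ring
    refine this.congr' ?_
    filter_upwards [self_mem_nhdsWithin] with x hx
    have hx : 0 < x := hx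
    have hP := Real.rpow_pos_of_pos hx p
    rw [Real.rpow_neg hx.le, Real.rpow_add hx, Real.rpow_one]
    unfold dd
    have e := mm_one_sub p x hx
    have e2 : 1 - LL p x = 1 / (2 + x ^ p) := by
      unfold LL; field_simp; ring
    have e3 : (1 - mm p x) * (LL p x * (1 - LL p x)) = (1 - (x ^ p) ^ 2) / 2 * (1 / (2 + x ^ p)) := by
      rw [← e, ← e2]; ring
    rw [e3]
    have e4 : x ^ p * ((((x ^ p)⁻¹) ^ 2 - 1) / (2 * (x ^ p)⁻¹ + 1) / 2) = (1 - (x ^ p) ^ 2) / 2 * (1 / (2 + x ^ p)) := by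
      field_simp
      try ring
    linear_combination (-x * (1 / p)) * e4
  have hl := ((tend_id.mul hcq).sub hdd).mul (hCq.sub (tend_id.mul hCp))
  have hlt := hl.eventually_lt hr (by norm_num)
  filter_upwards [hlt, self_mem_nhdsWithin] with x h hx
  have hx : 0 < x := hx
  refine lt_of_eq_of_lt ?_ h
  rw [mu_eq_neg p x hp.ne hx, mu_eq q x hq.ne' hx]
  ring

theorem mean_eq (x θ r : ℝ) (hr : r ≠ 0) (hx0 : 0 < x) (hx1 : x < 1) (hu : Real.sin θ ^ 2 < 1) :
    Matrix.rpowH ((2 : ℂ)⁻¹ •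
            (Matrix.rpowH (Matrix.diagonal ![1, (x : ℂ)]) r +
              Matrix.rpowH (rotC θ * Matrix.diagonal ![1, (x : ℂ) ^ 2] * (rotC θ)ᵀ) r)) (1 / r) =
    symC (F11 (LL r x) (mm r x) (1 / r) (Real.sin θ ^ 2))
      (Real.sin θ * Real.cos θ * F12 (LL r x) (mm r x) (1 / r) (Real.sin θ ^ 2))
      (F22 (LL r x) (mm r x) (1 / r) (Real.sin θ ^ 2)) := by
  rw [diag_eq, rot_eq, diag_rpow x r hx0 hx1, rot_rpow x r θ hx0 hx1,
    ← F_rpow _ _ _ _ (mm_ne r x hr hx0 hx1) hu, mm_one_sub r x hx0]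
  congr 1
  ext i j
  fin_cases i <;> fin_cases j <;> simp [symC, mm] <;> ring

theorem symC_sub (a b d a2 b2 d2 : ℝ) :
    symC a b d - symC a2 b2 d2 = symC (a - a2) (b - b2) (d - d2) := by
  ext i j
  fin_cases i <;> fin_cases j <;> simp [symC]

theorem symC_det (a b d : ℝ) : (symC a b d).det = ((a * d - b * b : ℝ) : ℂ) := by
  simp [symC, Matrix.det_fin_two]

/-- For `-1 < p < 1/2`, `p ≠ 0` and `q > max {0, p}`, the power mean inequality
`((A^p + B^p)/2)^(1/p) ≤ ((A^q + B^q)/2)^(1/q)` fails for some `2 × 2` positive definite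
matrices, which can be taken of the form `A = diag(1, x)`, `B = R_θ diag(1, x²) R_θᵀ`
with `x ∈ (0, 1)` and `θ > 0`. -/
theorem powerMean_counterexample_low_case (p q : ℝ)
    (hp1 : -1 < p) (hp2 : p < 1 / 2) (hp0 : p ≠ 0) (hq : max 0 p < q) :
    ∃ x θ : ℝ, 0 < x ∧ x < 1 ∧ 0 < θ ∧
      (Matrix.diagonal ![1, (x : ℂ)]).PosDef ∧
      (rotC θ * Matrix.diagonal ![1, (x : ℂ) ^ 2] * (rotC θ)ᵀ).PosDef ∧
      ¬ (Matrix.rpowH ((2 : ℂ)⁻¹ •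
            (Matrix.rpowH (Matrix.diagonal ![1, (x : ℂ)]) q +
              Matrix.rpowH (rotC θ * Matrix.diagonal ![1, (x : ℂ) ^ 2] * (rotC θ)ᵀ) q)) (1 / q) -
          Matrix.rpowH ((2 : ℂ)⁻¹ •
            (Matrix.rpowH (Matrix.diagonal ![1, (x : ℂ)]) p +
              Matrix.rpowH (rotC θ * Matrix.diagonal ![1, (x : ℂ) ^ 2] * (rotC θ)ᵀ) p)) (1 / p)).PosSemidef := by
  have hq0 : 0 < q := lt_of_le_of_lt (le_max_left _ _) hq
  have hpq : p < q := lt_of_le_of_lt (le_max_right _ _) hq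
  have hev : ∀ᶠ x in 𝓝[>] (0 : ℝ), (dd q x - dd p x) * (mm q x ^ (1 / q) - mm p x ^ (1 / p)) <
      (LL q x * (1 - mm q x ^ (1 / q)) - LL p x * (1 - mm p x ^ (1 / p))) ^ 2 := by
    rcases lt_or_gt_of_ne hp0 with h | h
    · exact exists_x_neg p q hp1 h hq0
    · exact exists_x_pos p q h hp2 hpq
  have hlt : ∀ᶠ x in 𝓝[>] (0 : ℝ), x < 1 := nhdsWithin_le_nhds (gt_mem_nhds one_pos)
  obtain ⟨x, hx, hx1, hx0⟩ := (hev.and (hlt.and self_mem_nhdsWithin)).exists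
  have hx0 : 0 < x := hx0
  obtain ⟨u, hu0, hu1, hu⟩ := exists_u (LL q x) (mm q x) (1 / q) (LL p x) (mm p x) (1 / p)
    (mm_pos q x hx0) (mm_ne q x hq0.ne' hx0 hx1) (mm_pos p x hx0) (mm_ne p x hp0 hx0 hx1) hx
  have hsu : √u ≤ 1 := Real.sqrt_le_one.mpr hu1.le
  have hsu0 : 0 < √u := Real.sqrt_pos.mpr hu0
  have hsin : Real.sin (Real.arcsin √u) ^ 2 = u := by
    rw [Real.sin_arcsin (by linarith) hsu, Real.sq_sqrt hu0.le]
  have hcos : Real.cos (Real.arcsin √u) ^ 2 = 1 - u := by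
    linarith [Real.sin_sq_add_cos_sq (Real.arcsin √u)]
  refine ⟨x, Real.arcsin √u, hx0, hx1, Real.arcsin_pos.mpr hsu0, ?_, ?_, ?_⟩
  · rw [diag_eq]
    exact symC_posDef _ _ _ one_pos (by linarith)
  · rw [rot_eq]
    have hx2 : x ^ 2 < 1 := by nlinarith
    refine symC_posDef _ _ _ ?_ ?_
    · rw [hsin]; nlinarith [sq_nonneg x]
    · have : (1 - Real.sin (Real.arcsin √u) ^ 2 * (1 - x ^ 2)) *
          (x ^ 2 + Real.sin (Real.arcsin √u) ^ 2 * (1 - x ^ 2)) -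
          Real.sin (Real.arcsin √u) * Real.cos (Real.arcsin √u) * (1 - x ^ 2) *
          (Real.sin (Real.arcsin √u) * Real.cos (Real.arcsin √u) * (1 - x ^ 2)) = x ^ 2 := by
        linear_combination (- Real.sin (Real.arcsin √u) ^ 2 * (1 - x ^ 2) ^ 2) * hcos +
          (- Real.sin (Real.arcsin √u) ^ 2 * (1 - x ^ 2) ^ 2) * hsin
      rw [this]; positivity
  · rw [mean_eq x _ q hq0.ne' hx0 hx1 (by rw [hsin]; exact hu1),
      mean_eq x _ p hp0 hx0 hx1 (by rw [hsin]; exact hu1)]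
    intro hps
    have hdet := hps.det_nonneg
    rw [symC_sub, symC_det, Complex.zero_le_real, hsin] at hdet
    have e : Real.sin (Real.arcsin √u) ^ 2 * Real.cos (Real.arcsin √u) ^ 2 = u * (1 - u) := by
      rw [hsin, hcos]
    refine absurd hu (not_lt.mpr (hdet.trans_eq ?_))
    linear_combination (- (F12 (LL q x) (mm q x) (1 / q) u - F12 (LL p x) (mm p x) (1 / p) u) ^ 2) * e
end

section
/- Let p, q be real numbers with 0 < p < q < 1. Then there exist 2×2 positive definite complex matrices A, B such that the power mean inequality ((A^p + B^p)/2)^{1/p} ≤ ((A^q + B^q)/2)^{1/q} fails, i.e., ((A^q + B^q)/2)^{1/q} − ((A^p + B^p)/2)^{1/p} is not positive semidefinite. -/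
open scoped ComplexOrder

namespace PM
open Matrix

noncomputable def S (a b d : ℝ) : Matrix (Fin 2) (Fin 2) ℂ := !![(a:ℂ), (b:ℂ); (b:ℂ), (d:ℂ)]

lemma S_herm (a b d : ℝ) : (S a b d).IsHermitian := by
  ext i j; fin_cases i <;> fin_cases j <;> simp [S]

lemma S_eig (a b d : ℝ) (i : Fin 2) :
    ((S_herm a b d).eigenvalues i - a) * ((S_herm a b d).eigenvalues i - d) = b ^ 2 := by
  set l := (S_herm a b d).eigenvalues i with hl
  have h := (S_herm a b d).mulVec_eigenvectorBasis i
  have hne : (S_herm a b d).eigenvectorBasis i ≠ 0 :=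
    (S_herm a b d).eigenvectorBasis.orthonormal.ne_zero i
  set v := (S_herm a b d).eigenvectorBasis i with hv
  rw [← hl] at h
  have h0 := congrFun h 0
  have h1 := congrFun h 1
  simp [S, Matrix.mulVec, dotProduct, Fin.sum_univ_two] at h0 h1
  have key : ((l - a) * (l - d) - b ^ 2 : ℂ) = 0 := by
    by_contra hk
    apply hne
    have e0 : ((l - a) * (l - d) - b ^ 2 : ℂ) * v 0 = 0 := by
      linear_combination (-(l:ℂ) + d) * h0 - b * h1
    have e1 : ((l - a) * (l - d) - b ^ 2 : ℂ) * v 1 = 0 := by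
      linear_combination (-(l:ℂ) + a) * h1 - b * h0
    ext j
    fin_cases j
    · simpa [hk] using e0
    · simpa [hk] using e1
  have : (l - a) * (l - d) - b ^ 2 = 0 := by exact_mod_cast key
  linarith

lemma cfc_S (f : ℝ → ℝ) (a b d x y c e : ℝ) (h1 : x + y = a + d) (h2 : x * y = a * d - b ^ 2)
    (hx : f x = c * x + e) (hy : f y = c * y + e) :
    Matrix.cfcReal f (S a b d) = S (c * a + e) (c * b) (c * d + e) := by
  have hA := S_herm a b d
  have hf : ∀ i, f (hA.eigenvalues i) = c * hA.eigenvalues i + e := by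
    intro i
    have h := S_eig a b d i
    have : (hA.eigenvalues i - x) * (hA.eigenvalues i - y) = 0 := by
      linear_combination h - hA.eigenvalues i * h1 + h2
    rcases mul_eq_zero.1 this with h | h
    · rw [sub_eq_zero.1 h, hx]
    · rw [sub_eq_zero.1 h, hy]
  have hs := hA.spectral_theorem
  have hS : S (c * a + e) (c * b) (c * d + e) = (c:ℂ) • S a b d + (e:ℂ) • 1 := by
    ext i j; fin_cases i <;> fin_cases j <;> simp [S]
  rw [hS, Matrix.cfcReal, dif_pos hA]
  have hd : Matrix.diagonal (fun i => (f (hA.eigenvalues i) : ℂ)) =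
      (c:ℂ) • Matrix.diagonal (RCLike.ofReal ∘ hA.eigenvalues : Fin 2 → ℂ) + (e:ℂ) • 1 := by
    ext i j
    by_cases hij : i = j
    · subst hij; simp [hf]
    · simp [hij]
  have hU : (hA.eigenvectorUnitary : Matrix (Fin 2) (Fin 2) ℂ) *
      star (hA.eigenvectorUnitary : Matrix (Fin 2) (Fin 2) ℂ) = 1 := by simp
  rw [hd]
  conv_rhs => rw [hs]
  rw [Unitary.conjStarAlgAut_apply]
  simp only [mul_add, add_mul, Matrix.mul_smul, Matrix.smul_mul, mul_one, hU]

noncomputable def R (k u y : ℝ) : Matrix (Fin 2) (Fin 2) ℂ := S (u + y) (k * u) (k ^ 2 * u + y)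

lemma R_pow (k u y r : ℝ) (hu : 0 < u) :
    Matrix.rpowH (R k u y) r = R k (((y + u * (1 + k ^ 2)) ^ r - y ^ r) / (1 + k ^ 2)) (y ^ r) := by
  set x := y + u * (1 + k ^ 2) with hxd
  have hk : 0 < 1 + k ^ 2 := by positivity
  have hu' := hu.ne'
  rw [Matrix.rpowH, R, cfc_S _ _ _ _ x y ((x ^ r - y ^ r) / (1 + k ^ 2) / u)
    (y ^ r - (x ^ r - y ^ r) / (1 + k ^ 2) / u * y)]
  · unfold R; congr 1 <;> field_simp <;> ring
  · rw [hxd]; ring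
  · rw [hxd]; ring
  · rw [hxd]; field_simp; ring
  · ring

lemma R_posDef (k u y : ℝ) (hu : 0 ≤ u) (hy : 0 < y) : (R k u y).PosDef := by
  have : R k u y = (u:ℂ) • Matrix.vecMulVec ![1, (k:ℂ)] (star ![1, (k:ℂ)]) + (y:ℂ) • 1 := by
    ext i j; fin_cases i <;> fin_cases j <;> simp [R, S, Matrix.vecMulVec] <;> ring
  rw [this]
  apply Matrix.PosDef.posSemidef_add
  · exact (Matrix.posSemidef_vecMulVec_self_star _).smul (by exact_mod_cast hu)
  · exact Matrix.PosDef.one.smul (by exact_mod_cast hy)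

/-- lower bound of the (1,1) entry of a power -/
lemma S_pow_lower (a b d r : ℝ) (ha : 0 < a) (hd : 0 ≤ d) (hb : b ≠ 0) (hdet : b ^ 2 ≤ a * d)
    (hr : 1 < r) : ∃ z : ℝ, Matrix.rpowH (S a b d) r 1 1 = (z : ℂ) ∧ a ^ (r - 2) * b ^ 2 ≤ z := by
  have hb2 : 0 < b ^ 2 := by positivity
  obtain ⟨w, hw, hw2⟩ : ∃ w : ℝ, 0 < w ∧ w ^ 2 = (a - d) ^ 2 + 4 * b ^ 2 :=
    ⟨√((a - d) ^ 2 + 4 * b ^ 2), by positivity, Real.sq_sqrt (by positivity)⟩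
  have hw1 : |a - d| < w := abs_lt_of_sq_lt_sq (by linarith) hw.le
  obtain ⟨hwa, hwb⟩ := abs_lt.1 hw1
  have hw3 : w ≤ a + d := by
    exact (abs_le_of_sq_le_sq' (by nlinarith) (by positivity)).2
  obtain ⟨x, hx⟩ : ∃ x, x = (a + d + w) / 2 := ⟨_, rfl⟩
  obtain ⟨y, hy⟩ : ∃ y, y = (a + d - w) / 2 := ⟨_, rfl⟩
  have hy0 : 0 ≤ y := by linarith
  have hxa : a ≤ x := by linarith
  have hx0 : 0 < x := by linarith
  have hxy : 0 < x - y := by linarith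
  have hdy : 0 < d - y := by linarith
  have hxd : 0 < x - d := by linarith
  have e1 : (d - y) * (a - y) = b ^ 2 := by rw [hy]; linear_combination hw2 / 4
  have hpow : a ^ (r - 2) * a = a ^ (r - 1) := by
    rw [← Real.rpow_add_one ha.ne']; congr 1; ring
  have hpowx : x ^ r = x ^ (r - 1) * x := by
    rw [← Real.rpow_add_one hx0.ne']; congr 1; ring
  have hc : ((x ^ r - y ^ r) / (x - y)) * d + (y ^ r * x - x ^ r * y) / (x - y) =
      x ^ r * (d - y) / (x - y) + y ^ r * (x - d) / (x - y) := by
    field_simp; ring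
  refine ⟨x ^ r * (d - y) / (x - y) + y ^ r * (x - d) / (x - y), ?_, ?_⟩
  · rw [← hc, Matrix.rpowH, cfc_S _ _ _ _ x y ((x ^ r - y ^ r) / (x - y))
      ((y ^ r * x - x ^ r * y) / (x - y))]
    · simp [S]
    · rw [hx, hy]; ring
    · rw [hx, hy]; linear_combination - hw2 / 4
    · field_simp; ring
    · field_simp; ring
  · have h2 : 0 ≤ y ^ r * (x - d) / (x - y) := by positivity
    have h3 : a ^ (r - 1) ≤ x ^ (r - 1) := Real.rpow_le_rpow ha.le hxa (by linarith)
    have h4 : x ^ (r - 1) * (d - y) ≤ x ^ r * (d - y) / (x - y) := by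
      rw [le_div_iff₀ hxy, hpowx]
      have : 0 ≤ x ^ (r - 1) * (d - y) := by positivity
      nlinarith
    have h5 : a ^ (r - 2) * b ^ 2 ≤ a ^ (r - 1) * (d - y) := by
      rw [← hpow, ← e1]
      have : 0 ≤ a ^ (r - 2) * (d - y) := by positivity
      nlinarith
    have h6 := mul_le_mul_of_nonneg_right h3 hdy.le
    linarith

lemma S_diag_pow (a d r : ℝ) (had : a ≠ d) : Matrix.rpowH (S a 0 d) r 1 1 = ((d ^ r : ℝ) : ℂ) := by
  have : a - d ≠ 0 := sub_ne_zero.2 had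
  rw [Matrix.rpowH, cfc_S _ _ _ _ a d ((a ^ r - d ^ r) / (a - d))
      (d ^ r - (a ^ r - d ^ r) / (a - d) * d)]
  · simp [S]
  · ring
  · ring
  · field_simp; ring
  · ring

noncomputable def U (θ t : ℝ) : ℝ := ((2 + 3 * t ^ 2) ^ θ - (t ^ 2) ^ θ) / (1 + t ^ 2)
noncomputable def V (θ t : ℝ) : ℝ := ((1 + 5 * t ^ 2) ^ θ - (t ^ 2) ^ θ) / (1 + (-2 * t) ^ 2)

lemma half_add (t u v e : ℝ) : (2:ℂ)⁻¹ • (R t u e + R (-2 * t) v e) =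
    S ((u + v) / 2 + e) (t * ((u - 2 * v) / 2)) (t ^ 2 * ((u + 4 * v) / 2) + e) := by
  ext i j; fin_cases i <;> fin_cases j <;> simp [R, S] <;> ring

lemma exists_t (θ r s : ℝ) (h0 : 0 < θ) (h1 : θ < 1) (hs : 1 < s) : ∃ t : ℝ, 0 < t ∧ t < 1/2 ∧
    U θ t - 2 * V θ t ≠ 0 ∧ (4 * t ^ 2) ^ s <
      ((U θ t + V θ t) / 2 + (t ^ 2) ^ θ) ^ (r - 2) * (t * ((U θ t - 2 * V θ t) / 2)) ^ 2 := by
  have hcp : ∀ z : ℝ, 0 < z → Continuous fun t : ℝ => (t ^ 2) ^ z := fun z hz =>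
    (continuous_pow 2).rpow_const (fun _ => Or.inr hz.le)
  have hU : Continuous (U θ) := by
    unfold U
    refine Continuous.div (Continuous.sub (Continuous.rpow_const (by fun_prop) fun _ => Or.inr h0.le)
      (hcp θ h0)) (by fun_prop) (fun t => by positivity)
  have hV : Continuous (V θ) := by
    unfold V
    refine Continuous.div (Continuous.sub (Continuous.rpow_const (by fun_prop) fun _ => Or.inr h0.le)
      (hcp θ h0)) (by fun_prop) (fun t => by positivity)
  have hU0 : U θ 0 = 2 ^ θ := by simp [U, h0.ne']
  have hV0 : V θ 0 = 1 := by simp [V, h0.ne']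
  have h2 : (2:ℝ) ^ θ < 2 := by
    simpa using Real.rpow_lt_rpow_of_exponent_lt (x := 2) (by norm_num) h1
  have h2p : (0:ℝ) < 2 ^ θ := by positivity
  have hg : ContinuousAt (fun t => ((U θ t + V θ t) / 2 + (t ^ 2) ^ θ) ^ (r - 2) *
      ((U θ t - 2 * V θ t) / 2) ^ 2 - 4 ^ s * (t ^ 2) ^ (s - 1)) 0 := by
    have hc := hcp θ h0
    have hc' := hcp (s - 1) (by linarith)
    refine ContinuousAt.sub (ContinuousAt.mul (ContinuousAt.rpow_const (by fun_prop) (Or.inl ?_))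
      (by fun_prop)) (continuous_const.mul hc').continuousAt
    rw [hU0, hV0]; positivity
  have hpos : ∀ᶠ t in nhds (0:ℝ), 0 < ((U θ t + V θ t) / 2 + (t ^ 2) ^ θ) ^ (r - 2) *
      ((U θ t - 2 * V θ t) / 2) ^ 2 - 4 ^ s * (t ^ 2) ^ (s - 1) := by
    refine hg.eventually_const_lt ?_
    beta_reduce
    rw [hU0, hV0]
    have : ((2:ℝ) ^ θ - 2 * 1) / 2 ≠ 0 := by
      intro h; linarith
    have h3 : ((0:ℝ) ^ 2) ^ (s - 1) = 0 := by
      rw [zero_pow two_ne_zero, Real.zero_rpow (by linarith)]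
    rw [h3]
    simp only [mul_zero, sub_zero]
    positivity
  have hne : ∀ᶠ t in nhds (0:ℝ), U θ t - 2 * V θ t < 0 := by
    have hct : ContinuousAt (fun t => U θ t - 2 * V θ t) 0 := by fun_prop
    refine Filter.Tendsto.eventually_lt_const ?_ hct
    beta_reduce
    rw [hU0, hV0]; linarith
  have hlt : ∀ᶠ t in nhds (0:ℝ), t < 1/2 := eventually_lt_nhds (by norm_num)
  have hall := (hpos.and (hne.and hlt)).filter_mono (nhdsWithin_le_nhds (s := Set.Ioi (0:ℝ)))
  obtain ⟨t, ⟨ha, hb, hc⟩, ht⟩ := (hall.and self_mem_nhdsWithin).exists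
  have ht : 0 < t := ht
  refine ⟨t, ht, hc, hb.ne, ?_⟩
  have e : (4 * t ^ 2) ^ s = 4 ^ s * (t ^ 2) ^ (s - 1) * t ^ 2 := by
    rw [Real.mul_rpow (by norm_num) (by positivity), mul_assoc, ← Real.rpow_add_one (by positivity)]
    congr 2; ring
  rw [e, mul_pow]
  have : 0 < t ^ 2 := by positivity
  nlinarith [mul_pos ha this]

end PM

/-- For `0 < p < q < 1`, there exist `2 × 2` positive definite complex matrices `A, B`
for which the power mean inequality `((A^p + B^p)/2)^(1/p) ≤ ((A^q + B^q)/2)^(1/q)` fails. -/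
theorem powerMean_counterexample_middle_case (p q : ℝ)
    (hp : 0 < p) (hpq : p < q) (hq : q < 1) :
    ∃ A B : Matrix (Fin 2) (Fin 2) ℂ, A.PosDef ∧ B.PosDef ∧
      ¬ (Matrix.rpowH ((2 : ℂ)⁻¹ • (Matrix.rpowH A q + Matrix.rpowH B q)) (1 / q) -
          Matrix.rpowH ((2 : ℂ)⁻¹ • (Matrix.rpowH A p + Matrix.rpowH B p)) (1 / p)).PosSemidef := by
  have hq0 : 0 < q := hp.trans hpq
  have hθ0 : 0 < p / q := by positivity
  have hθ1 : p / q < 1 := (div_lt_one hq0).2 hpq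
  have hs : 1 < 1 / q := by rw [lt_div_iff₀ hq0]; linarith
  have hr : 1 < 1 / p := by rw [lt_div_iff₀ hp]; linarith
  obtain ⟨t, ht0, ht1, hne, hlt⟩ := PM.exists_t (p / q) (1 / p) (1 / q) hθ0 hθ1 hs
  have ht2 : 0 < t ^ 2 := by positivity
  have hq1 : 0 < 1 / q := by positivity
  have upos : ∀ z : ℝ, 0 < z → 0 < PM.U z t := fun z hz => by
    unfold PM.U
    have := Real.rpow_lt_rpow ht2.le (show t ^ 2 < 2 + 3 * t ^ 2 by nlinarith) hz
    have : 0 < (2 + 3 * t ^ 2) ^ z - (t ^ 2) ^ z := by linarith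
    positivity
  have vpos : ∀ z : ℝ, 0 < z → 0 < PM.V z t := fun z hz => by
    unfold PM.V
    have := Real.rpow_lt_rpow ht2.le (show t ^ 2 < 1 + 5 * t ^ 2 by nlinarith) hz
    have : 0 < (1 + 5 * t ^ 2) ^ z - (t ^ 2) ^ z := by linarith
    positivity
  have hApow : ∀ z : ℝ, Matrix.rpowH (PM.R t (PM.U (1 / q) t) ((t ^ 2) ^ (1 / q))) z =
      PM.R t (PM.U (z / q) t) ((t ^ 2) ^ (z / q)) := fun z => by
    rw [PM.R_pow _ _ _ _ (upos _ hq1)]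
    have e1 : (t ^ 2) ^ (1 / q) + PM.U (1 / q) t * (1 + t ^ 2) = (2 + 3 * t ^ 2) ^ (1 / q) := by
      unfold PM.U
      rw [div_mul_cancel₀ _ (by positivity)]; ring
    rw [e1, ← Real.rpow_mul (by positivity), ← Real.rpow_mul (by positivity), one_div_mul_eq_div]
    rfl
  have hBpow : ∀ z : ℝ, Matrix.rpowH (PM.R (-2 * t) (PM.V (1 / q) t) ((t ^ 2) ^ (1 / q))) z =
      PM.R (-2 * t) (PM.V (z / q) t) ((t ^ 2) ^ (z / q)) := fun z => by
    rw [PM.R_pow _ _ _ _ (vpos _ hq1)]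
    have e1 : (t ^ 2) ^ (1 / q) + PM.V (1 / q) t * (1 + (-2 * t) ^ 2) =
        (1 + 5 * t ^ 2) ^ (1 / q) := by
      unfold PM.V
      rw [div_mul_cancel₀ _ (by positivity)]; ring
    rw [e1, ← Real.rpow_mul (by positivity), ← Real.rpow_mul (by positivity), one_div_mul_eq_div]
    rfl
  refine ⟨PM.R t (PM.U (1 / q) t) ((t ^ 2) ^ (1 / q)),
    PM.R (-2 * t) (PM.V (1 / q) t) ((t ^ 2) ^ (1 / q)),
    PM.R_posDef _ _ _ (upos _ hq1).le (by positivity),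
    PM.R_posDef _ _ _ (vpos _ hq1).le (by positivity), ?_⟩
  intro hpsd
  have hdiag := hpsd.diag_nonneg (i := 1)
  rw [hApow, hApow, hBpow, hBpow, div_self hq0.ne', PM.half_add, PM.half_add] at hdiag
  have hU1 : PM.U 1 t = 2 := by
    unfold PM.U; rw [Real.rpow_one, Real.rpow_one]; field_simp; ring
  have hV1 : PM.V 1 t = 1 := by
    unfold PM.V; rw [Real.rpow_one, Real.rpow_one, div_eq_one_iff_eq (by positivity)]; ring
  rw [hU1, hV1, Real.rpow_one, show t * ((2 - 2 * 1) / 2) = 0 by ring,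
    show t ^ 2 * ((2 + 4 * 1) / 2) + t ^ 2 = 4 * t ^ 2 by ring] at hdiag
  have hu := upos _ hθ0
  have hv := vpos _ hθ0
  obtain ⟨z, hz, hz2⟩ := PM.S_pow_lower ((PM.U (p / q) t + PM.V (p / q) t) / 2 + (t ^ 2) ^ (p / q))
    (t * ((PM.U (p / q) t - 2 * PM.V (p / q) t) / 2))
    (t ^ 2 * ((PM.U (p / q) t + 4 * PM.V (p / q) t) / 2) + (t ^ 2) ^ (p / q)) (1 / p)
    (by positivity) (by positivity)
    (mul_ne_zero ht0.ne' (div_ne_zero hne two_ne_zero)) (by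
      have he : 0 < (t ^ 2) ^ (p / q) := by positivity
      generalize (t ^ 2) ^ (p / q) = e at *
      generalize PM.U (p / q) t = u at *
      generalize PM.V (p / q) t = v at *
      have : 0 ≤ (u + v) / 2 * e + e * (t ^ 2 * ((u + 4 * v) / 2)) + e ^ 2 + 9 / 4 * t ^ 2 * (u * v) := by
        positivity
      linarith) hr
  rw [Matrix.sub_apply, hz, PM.S_diag_pow _ _ _ (by nlinarith)] at hdiag
  have : 0 ≤ (4 * t ^ 2) ^ (1 / q) - z := by exact_mod_cast hdiag
  linarith
end
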